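/- arXiv:1708.02390 — 7 statements merged into one kernel-verified Lean document; each statement's English description precedes it below -/
import Mathlib

section
/- Let n ≥ 2 be an integer, s > n/2 a real number, and θ₀ ∈ (0, π). Every eigenvalue λ of L_s on [0, θ₀] satisfies λ > (s − 1)(s − n). -/
open Real Set Filter

/-- The operator `(L_s u)(θ) = -u''(θ) - (n+1-2s) cot(θ) u'(θ) + (s-1)(s-n) u(θ)`. -/
noncomputable def Ls (n : ℕ) (s : ℝ) (u : ℝ → ℝ) (θ : ℝ) : ℝ :=
  -deriv (deriv u) θ - ((n : ℝ) + 1 - 2 * s) * Real.cot θ * deriv u θ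
    + (s - 1) * (s - (n : ℝ)) * u θ

/-- `lam` is an eigenvalue of `L_s` on `[0, θ₀]`: there is `v`, the restriction of a
`C^∞` function on `ℝ`, not identically zero on `[0, θ₀]`, such that
`u(θ) = sin(θ)^{2s-n} v(θ)` satisfies `L_s u = lam·u` on `(0, θ₀)` and `u'(θ₀) = 0`. -/
def IsEigenvalue (n : ℕ) (s θ₀ lam : ℝ) : Prop :=
  ∃ V : ℝ → ℝ, ContDiff ℝ (⊤ : ℕ∞) V ∧ (∃ θ ∈ Set.Icc 0 θ₀, V θ ≠ 0) ∧
    (∀ θ ∈ Set.Ioo 0 θ₀,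
      Ls n s (fun t => Real.sin t ^ (2 * s - (n : ℝ)) * V t) θ
        = lam * (Real.sin θ ^ (2 * s - (n : ℝ)) * V θ)) ∧
    deriv (fun t => Real.sin t ^ (2 * s - (n : ℝ)) * V t) θ₀ = 0

/-- The weighted derivative `sin^{1-a} (sin^a V)'`, written without powers of `sin`. -/
noncomputable def flux (a : ℝ) (V : ℝ → ℝ) (t : ℝ) : ℝ :=
  a * Real.cos t * V t + Real.sin t * deriv V t

lemma hasDerivAt_sin_rpow_mul {a t : ℝ} {V : ℝ → ℝ} (hV : DifferentiableAt ℝ V t)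
    (ht : 0 < Real.sin t) :
    HasDerivAt (fun t => Real.sin t ^ a * V t) (Real.sin t ^ (a - 1) * flux a V t) t := by
  have h := ((Real.hasDerivAt_sin t).rpow_const (p := a) (Or.inl ht.ne')).mul hV.hasDerivAt
  refine h.congr_deriv ?_
  have h1 : Real.sin t ^ a = Real.sin t ^ (a - 1) * Real.sin t := by
    rw [Real.rpow_sub_one ht.ne']; field_simp
  rw [h1, flux]; ring

lemma differentiable_flux {V : ℝ → ℝ} (a : ℝ) (hV : ContDiff ℝ (⊤ : ℕ∞) V) :
    Differentiable ℝ (flux a V) := by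
  have h1 : Differentiable ℝ V := hV.differentiable (by simp)
  have h2 : Differentiable ℝ (deriv V) :=
    ((contDiff_infty_iff_deriv.1 hV).2).differentiable (by simp)
  unfold flux
  fun_prop

/-- In terms of the flux, `L_s u = lam u` is a divergence-form equation. -/
lemma deriv_flux_of_Ls_eq {n : ℕ} {s lam θ : ℝ} {V : ℝ → ℝ} (hV : ContDiff ℝ (⊤ : ℕ∞) V)
    (hθ : 0 < Real.sin θ)
    (h : Ls n s (fun t => Real.sin t ^ (2 * s - (n : ℝ)) * V t) θ
        = lam * (Real.sin θ ^ (2 * s - (n : ℝ)) * V θ)) :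
    deriv (flux (2 * s - n) V) θ
      = -((lam - (s - 1) * (s - n)) * (Real.sin θ * V θ)) := by
  have hV1 : Differentiable ℝ V := hV.differentiable (by simp)
  obtain ⟨a, ha⟩ : ∃ a : ℝ, a = 2 * s - n := ⟨_, rfl⟩
  have hc : (n : ℝ) + 1 - 2 * s = 1 - a := by rw [ha]; ring
  rw [Ls, hc, ← ha] at h
  rw [← ha]
  have hev : deriv (fun t => Real.sin t ^ a * V t) =ᶠ[nhds θ]
      fun t => Real.sin t ^ (a - 1) * flux a V t := by
    filter_upwards [Real.continuous_sin.continuousAt.eventually (lt_mem_nhds hθ)] with t ht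
    exact (hasDerivAt_sin_rpow_mul (hV1 t) ht).deriv
  have hd : deriv (deriv (fun t => Real.sin t ^ a * V t)) θ
      = Real.cos θ * (a - 1) * Real.sin θ ^ (a - 1 - 1) * flux a V θ
        + Real.sin θ ^ (a - 1) * deriv (flux a V) θ := by
    rw [hev.deriv_eq]
    exact (((Real.hasDerivAt_sin θ).rpow_const (p := a - 1) (Or.inl hθ.ne')).mul
      (differentiable_flux a hV θ).hasDerivAt).deriv
  rw [hd, hev.eq_of_nhds, Real.cot_eq_cos_div_sin, Real.rpow_sub_one hθ.ne',
    Real.rpow_sub_one hθ.ne'] at h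
  have hP : Real.sin θ ^ a ≠ 0 := (Real.rpow_pos_of_pos hθ a).ne'
  refine mul_left_cancel₀ hθ.ne' ?_
  field_simp at h
  linarith

/-- A function with nonnegative derivative that agrees at both endpoints has zero derivative. -/
lemma deriv_eq_zero_of_nonneg_of_eq {g g' : ℝ → ℝ} {a b : ℝ} (hc : ContinuousOn g (Icc a b))
    (hd : ∀ x ∈ Ioo a b, HasDerivAt g (g' x) x) (hnn : ∀ x ∈ Ioo a b, 0 ≤ g' x)
    (hab : g a = g b) : ∀ x ∈ Ioo a b, g' x = 0 := by
  intro x hx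
  have hab' : a ≤ b := (hx.1.trans hx.2).le
  have hm : MonotoneOn g (Icc a b) :=
    monotoneOn_of_hasDerivWithinAt_nonneg (convex_Icc a b) hc
      (fun y hy => (hd y (by rwa [interior_Icc] at hy)).hasDerivWithinAt)
      (fun y hy => hnn y (by rwa [interior_Icc] at hy))
  have hconst : g =ᶠ[nhds x] fun _ => g a := by
    filter_upwards [Icc_mem_nhds hx.1 hx.2] with y hy
    exact le_antisymm ((hm hy (right_mem_Icc.2 hab') hy.2).trans hab.ge)
      (hm (left_mem_Icc.2 hab') hy hy.1)
  exact (hd x hx).unique ((hasDerivAt_const x (g a)).congr_of_eventuallyEq hconst)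

/-- every eigenvalue of `L_s` on `[0, θ₀]` is `> (s-1)(s-n)`. -/
theorem stmt_2 (n : ℕ) (hn : 2 ≤ n) (s : ℝ) (hs : (n : ℝ) / 2 < s)
    (θ₀ : ℝ) (hθ₀ : θ₀ ∈ Set.Ioo 0 Real.pi)
    (lam : ℝ) (hlam : IsEigenvalue n s θ₀ lam) :
    (s - 1) * (s - (n : ℝ)) < lam := by
  obtain ⟨V, hV, ⟨θ₁, hθ₁, hne⟩, heq, hbd⟩ := hlam
  by_contra! hle
  have hV1 : Differentiable ℝ V := hV.differentiable (by simp)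
  have hflux : ∀ θ ∈ Ioo 0 θ₀, deriv (flux (2 * s - n) V) θ
      = -((lam - (s - 1) * (s - n)) * (Real.sin θ * V θ)) := fun θ hθ =>
    deriv_flux_of_Ls_eq hV (Real.sin_pos_of_pos_of_lt_pi hθ.1 (hθ.2.trans hθ₀.2)) (heq θ hθ)
  have ha : 0 < 2 * s - (n : ℝ) := by linarith
  generalize 2 * s - (n : ℝ) = a at *
  have hsin : ∀ θ ∈ Ioc 0 θ₀, 0 < Real.sin θ := fun θ hθ =>
    Real.sin_pos_of_pos_of_lt_pi hθ.1 (hθ.2.trans_lt hθ₀.2)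
  have hW := differentiable_flux a hV
  have hu : Continuous fun t => Real.sin t ^ a * V t :=
    (Real.continuous_sin.rpow_const fun _ => Or.inr ha.le).mul hV1.continuous
  have hu0 : Real.sin 0 ^ a * V 0 = 0 := by simp [Real.zero_rpow ha.ne']
  have hW0 : flux a V θ₀ = 0 := by
    have hs0 := hsin θ₀ ⟨hθ₀.1, le_rfl⟩
    rw [(hasDerivAt_sin_rpow_mul (hV1 θ₀) hs0).deriv] at hbd
    exact (mul_eq_zero.1 hbd).resolve_left (Real.rpow_pos_of_pos hs0 _).ne'
  have hpos : ∀ θ ∈ Ioo 0 θ₀, 0 ≤ Real.sin θ ^ a * V θ * deriv (flux a V) θ := by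
    intro θ hθ
    have hs0 := hsin θ ⟨hθ.1, hθ.2.le⟩
    have h1 : Real.sin θ ^ a * V θ * deriv (flux a V) θ
        = ((s - 1) * (s - n) - lam) * (Real.sin θ ^ a * Real.sin θ * V θ ^ 2) := by
      rw [hflux θ hθ]; ring
    rw [h1]
    have := sub_nonneg.2 hle
    have := Real.rpow_pos_of_pos hs0 a
    positivity
  have hpos' : ∀ θ ∈ Ioo 0 θ₀,
      0 ≤ Real.sin θ ^ (a - 1) * flux a V θ * flux a V θ := by
    intro θ hθ
    have := Real.rpow_pos_of_pos (hsin θ ⟨hθ.1, hθ.2.le⟩) (a - 1)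
    rw [mul_assoc]
    exact mul_nonneg this.le (mul_self_nonneg _)
  have hzero := deriv_eq_zero_of_nonneg_of_eq (hu.mul hW.continuous).continuousOn
    (fun θ hθ => (hasDerivAt_sin_rpow_mul (hV1 θ) (hsin θ ⟨hθ.1, hθ.2.le⟩)).mul
      (hW θ).hasDerivAt)
    (fun θ hθ => add_nonneg (hpos' θ hθ) (hpos θ hθ))
    (by simp [hW0, Real.zero_rpow ha.ne'])
  have hWz : ∀ θ ∈ Ioo 0 θ₀, Real.sin θ ^ (a - 1) * flux a V θ = 0 := by
    intro θ hθ
    have h0 : Real.sin θ ^ (a - 1) * flux a V θ * flux a V θ = 0 := by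
      linarith [hzero θ hθ, hpos θ hθ, hpos' θ hθ]
    rcases mul_eq_zero.1 h0 with h | h
    · exact h
    · rw [h, mul_zero]
  have huz : ∀ θ ∈ Icc 0 θ₀, Real.sin θ ^ a * V θ = 0 := by
    intro θ hθ
    rcases hθ.1.eq_or_lt with rfl | h0
    · exact hu0
    obtain ⟨c, hc, hc'⟩ := exists_hasDerivAt_eq_slope (fun t => Real.sin t ^ a * V t)
      (fun t => Real.sin t ^ (a - 1) * flux a V t) h0 hu.continuousOn
      fun x hx => hasDerivAt_sin_rpow_mul (hV1 x) (hsin x ⟨hx.1, hx.2.le.trans hθ.2⟩)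
    rw [hWz c ⟨hc.1, hc.2.trans_le hθ.2⟩, hu0, sub_zero, sub_zero] at hc'
    exact (div_eq_zero_iff.1 hc'.symm).resolve_right h0.ne'
  have hVz : EqOn V 0 (Ioc 0 θ₀) := fun θ hθ =>
    (mul_eq_zero.1 (huz θ ⟨hθ.1.le, hθ.2⟩)).resolve_left
      (Real.rpow_pos_of_pos (hsin θ hθ) a).ne'
  have hVz' := hVz.closure hV1.continuous continuous_const
  rw [closure_Ioc hθ₀.1.ne] at hVz'
  exact hne (hVz' hθ₁)
end

section
/- Let n ≥ 2 be an integer, s > n/2 a real number, and θ₀ ∈ (π/2, π). If λ₀ is an eigenvalue of L_s on [0, θ₀] such that every eigenvalue λ of L_s on [0, θ₀] satisfies λ₀ ≤ λ, then (s − 1)(s − n) < λ₀ < s(s + 1 − n). -/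
open Real Set Filter

section LiouvilleForm

theorem hasDerivAt_sin_rpow_mul_s6 {a θ f' : ℝ} {f : ℝ → ℝ} (hθ : 0 < sin θ)
    (hf : HasDerivAt f f' θ) :
    HasDerivAt (fun t => sin t ^ a * f t)
      (sin θ ^ (a - 1) * (a * cos θ * f θ + sin θ * f')) θ := by
  have h1 : HasDerivAt (fun t => sin t ^ a) (cos θ * a * sin θ ^ (a - 1)) θ :=
    (hasDerivAt_sin θ).rpow_const (Or.inl hθ.ne')
  have h2 : sin θ ^ a = sin θ ^ (a - 1) * sin θ := by
    rw [rpow_sub_one hθ.ne', div_mul_cancel₀ _ hθ.ne']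
  refine (h1.mul hf).congr_deriv ?_
  rw [h2]
  ring

/-- In terms of the flux `p = sin^{1-a} u'`, with `a = 2s - n` and `u = sin^a V`,
the operator reads `L_s u = (s-1)(s-n) u - sin^{a-1} p'`. -/
theorem Ls_sin_rpow_mul {n : ℕ} {s θ p' : ℝ} {V V' : ℝ → ℝ} (hθ : 0 < sin θ)
    (hV : ∀ᶠ t in nhds θ, HasDerivAt V (V' t) t)
    (hp : HasDerivAt (fun t => (2 * s - (n : ℝ)) * cos t * V t + sin t * V' t) p' θ) :
    Ls n s (fun t => sin t ^ (2 * s - (n : ℝ)) * V t) θ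
      = (s - 1) * (s - (n : ℝ)) * (sin θ ^ (2 * s - (n : ℝ)) * V θ)
        - sin θ ^ (2 * s - (n : ℝ) - 1) * p' := by
  have hpos : ∀ᶠ t in nhds θ, 0 < sin t :=
    continuous_sin.continuousAt.eventually (lt_mem_nhds hθ)
  have hd : deriv (fun t => sin t ^ (2 * s - (n : ℝ)) * V t) =ᶠ[nhds θ]
      fun t => sin t ^ (2 * s - (n : ℝ) - 1)
        * ((2 * s - (n : ℝ)) * cos t * V t + sin t * V' t) := by
    filter_upwards [hV, hpos] with t ht ht0
    exact (hasDerivAt_sin_rpow_mul_s6 ht0 ht).deriv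
  have hdd := (hasDerivAt_sin_rpow_mul_s6 (a := 2 * s - (n : ℝ) - 1) hθ hp).deriv
  unfold Ls
  rw [hd.deriv_eq, hdd, hd.eq_of_nhds, rpow_sub_one hθ.ne' (2 * s - (n : ℝ) - 1), cot_eq_cos_div_sin]
  field_simp
  ring

theorem sub_lt_of_isEigenvalue {n : ℕ} {s θ₀ lam : ℝ} (hs : (n : ℝ) / 2 < s)
    (hθ₀ : θ₀ ∈ Set.Ioo 0 π) (h : IsEigenvalue n s θ₀ lam) :
    (s - 1) * (s - (n : ℝ)) < lam := by
  obtain ⟨V, hV, ⟨θ₁, hθ₁, hne⟩, hL, hbd⟩ := h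
  by_contra! hle
  have hsin : ∀ t ∈ Set.Ioc 0 θ₀, 0 < sin t := fun t ht =>
    sin_pos_of_pos_of_lt_pi ht.1 (ht.2.trans_lt hθ₀.2)
  have hVd : ∀ t, HasDerivAt V (deriv V t) t := fun t =>
    (hV.differentiable (by simp) t).hasDerivAt
  have hVdd : Differentiable ℝ (deriv V) :=
    ((contDiff_infty_iff_deriv.1 hV).2).differentiable (by simp)
  set a : ℝ := 2 * s - (n : ℝ) with ha
  have ha0 : 0 < a := by linarith
  set p : ℝ → ℝ := fun t => a * cos t * V t + sin t * deriv V t with hp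
  have hpd : Differentiable ℝ p := by
    have := hV.differentiable (by simp)
    fun_prop
  set u : ℝ → ℝ := fun t => sin t ^ a * V t with hu
  have hud : ∀ t ∈ Set.Ioc 0 θ₀, HasDerivAt u (sin t ^ (a - 1) * p t) t := fun t ht =>
    hasDerivAt_sin_rpow_mul_s6 (hsin t ht) (hVd t)
  have hflux : ∀ t ∈ Set.Ioo 0 θ₀,
      deriv p t = ((s - 1) * (s - (n : ℝ)) - lam) * (sin t * V t) := by
    intro t ht
    have h0 := hsin t ⟨ht.1, ht.2.le⟩
    have h1 := Ls_sin_rpow_mul h0 (Eventually.of_forall hVd) (hpd t).hasDerivAt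
    rw [hL t ht, ← ha] at h1
    have h2 : sin t ^ a = sin t ^ (a - 1) * sin t := by
      rw [rpow_sub_one h0.ne', div_mul_cancel₀ _ h0.ne']
    have h3 : sin t ^ (a - 1) ≠ 0 := (rpow_pos_of_pos h0 _).ne'
    apply mul_left_cancel₀ h3
    rw [h2] at h1
    linarith
  have hp0 : p θ₀ = 0 := by
    have h1 := (hud θ₀ ⟨hθ₀.1, le_rfl⟩).deriv
    rw [hbd] at h1
    exact (mul_eq_zero.1 h1.symm).resolve_left
      (rpow_pos_of_pos (hsin θ₀ ⟨hθ₀.1, le_rfl⟩) _).ne'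
  have hu0 : u 0 = 0 := by simp [hu, zero_rpow ha0.ne']
  have huc : Continuous u :=
    (continuous_sin.rpow_const fun _ => Or.inr ha0.le).mul hV.continuous
  have hqd : ∀ t ∈ Set.Ioo 0 θ₀, HasDerivAt (fun t => u t * p t)
      (sin t ^ (a - 1) * p t * p t
        + u t * (((s - 1) * (s - (n : ℝ)) - lam) * (sin t * V t))) t := by
    intro t ht
    rw [← hflux t ht]
    exact (hud t ⟨ht.1, ht.2.le⟩).mul (hpd t).hasDerivAt
  have hqpos : ∀ t ∈ Set.Ioo 0 θ₀,
      0 ≤ u t * (((s - 1) * (s - (n : ℝ)) - lam) * (sin t * V t)) := by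
    intro t ht
    have h0 := hsin t ⟨ht.1, ht.2.le⟩
    have h1 := rpow_pos_of_pos h0 a
    have h2 : u t * (((s - 1) * (s - (n : ℝ)) - lam) * (sin t * V t))
        = sin t ^ a * sin t * ((s - 1) * (s - (n : ℝ)) - lam) * V t ^ 2 := by
      simp only [hu]; ring
    rw [h2]
    have h3 := sub_nonneg.2 hle
    positivity
  have hmono : MonotoneOn (fun t => u t * p t) (Set.Icc 0 θ₀) := by
    apply monotoneOn_of_deriv_nonneg (convex_Icc _ _) (huc.mul hpd.continuous).continuousOn
    · rw [interior_Icc]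
      exact fun t ht => (hqd t ht).differentiableAt.differentiableWithinAt
    · rw [interior_Icc]
      intro t ht
      refine le_of_le_of_eq ?_ (hqd t ht).deriv.symm
      have h1 := rpow_pos_of_pos (hsin t ⟨ht.1, ht.2.le⟩) (a - 1)
      have h2 := hqpos t ht
      have h3 : 0 ≤ sin t ^ (a - 1) * p t * p t := by
        rw [mul_assoc]; exact mul_nonneg h1.le (mul_self_nonneg _)
      linarith
  have hq0 : ∀ t ∈ Set.Icc 0 θ₀, u t * p t = 0 := by
    intro t ht
    have h1 := hmono (left_mem_Icc.2 hθ₀.1.le) ht ht.1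
    have h2 := hmono ht (right_mem_Icc.2 hθ₀.1.le) ht.2
    simp only [hu0, hp0, zero_mul, mul_zero] at h1 h2
    exact le_antisymm h2 h1
  have hpz : ∀ t ∈ Set.Ioo 0 θ₀, p t = 0 := by
    intro t ht
    have h1 : (fun t => u t * p t) =ᶠ[nhds t] fun _ => 0 := by
      filter_upwards [Ioo_mem_nhds ht.1 ht.2] with x hx
      exact hq0 x ⟨hx.1.le, hx.2.le⟩
    have h2 := h1.deriv_eq
    rw [(hqd t ht).deriv, deriv_const] at h2
    have h3 := rpow_pos_of_pos (hsin t ⟨ht.1, ht.2.le⟩) (a - 1)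
    have h4 := hqpos t ht
    have h5 : 0 ≤ sin t ^ (a - 1) * (p t * p t) := mul_nonneg h3.le (mul_self_nonneg _)
    have h6 : sin t ^ (a - 1) * (p t * p t) = 0 := by linarith
    exact mul_self_eq_zero.1 ((mul_eq_zero.1 h6).resolve_left h3.ne')
  have huz : ∀ t ∈ Set.Icc 0 θ₀, u t = 0 := by
    intro t ht
    rcases ht.1.eq_or_lt with h | h
    · rw [← h, hu0]
    obtain ⟨x, hx, hx'⟩ := exists_hasDerivAt_eq_slope u (fun t => sin t ^ (a - 1) * p t) h
      huc.continuousOn fun x hx => hud x ⟨hx.1, hx.2.le.trans ht.2⟩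
    rw [hpz x ⟨hx.1, hx.2.trans_le ht.2⟩, mul_zero, hu0, sub_zero, sub_zero, eq_comm,
      div_eq_zero_iff] at hx'
    exact hx'.resolve_right h.ne'
  have hVz : ∀ t ∈ Set.Ioo 0 θ₀, V t = 0 := fun t ht =>
    (mul_eq_zero.1 (huz t ⟨ht.1.le, ht.2.le⟩)).resolve_left
      (rpow_pos_of_pos (hsin t ⟨ht.1, ht.2.le⟩) _).ne'
  have hcl : Set.EqOn V (fun _ => 0) (closure (Set.Ioo 0 θ₀)) :=
    Set.EqOn.closure hVz hV.continuous continuous_const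
  rw [closure_Ioo hθ₀.1.ne] at hcl
  exact hne (hcl hθ₁)

end LiouvilleForm

section PowerSeries

/-- The coefficients `c` are summable against every geometric sequence of ratio in `(0, 1)`. -/
def SummableOnUnitBall (c : ℕ → ℝ) : Prop :=
  ∀ r ∈ Set.Ioo (0 : ℝ) 1, Summable fun k => |c k| * r ^ k

namespace SummableOnUnitBall

variable {c : ℕ → ℝ}

theorem summable (hc : SummableOnUnitBall c) {x : ℝ} (hx : |x| < 1) :
    Summable fun k => c k * x ^ k := by
  obtain ⟨r, hr, hr1⟩ := exists_between hx
  refine Summable.of_norm_bounded (hc r ⟨(abs_nonneg x).trans_lt hr, hr1⟩) fun k => ?_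
  rw [norm_mul, norm_pow, Real.norm_eq_abs, Real.norm_eq_abs]
  gcongr

theorem natCast_mul (hc : SummableOnUnitBall c) : SummableOnUnitBall fun k => (k : ℝ) * c k := by
  intro r hr
  obtain ⟨R, hR, hR1⟩ := exists_between hr.2
  have hR0 : 0 < R := hr.1.trans hR
  have hq : |r / R| < 1 := by
    rw [abs_of_pos (div_pos hr.1 hR0), div_lt_one hR0]; exact hR
  have hlim : Tendsto (fun k : ℕ => (k : ℝ) * (r / R) ^ k) atTop (nhds 0) :=
    tendsto_self_mul_const_pow_of_abs_lt_one hq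
  have hev : ∀ᶠ k : ℕ in atTop, (k : ℝ) * (r / R) ^ k ≤ 1 :=
    (hlim.eventually (gt_mem_nhds one_pos)).mono fun _ h => h.le
  refine Summable.of_norm_bounded_eventually_nat (hc R ⟨hR0, hR1⟩) ?_
  filter_upwards [hev] with k hk
  have h1 : |(k : ℝ) * c k| * r ^ k = (k * (r / R) ^ k) * (|c k| * R ^ k) := by
    rw [abs_mul, Nat.abs_cast, div_pow]
    field_simp
  rw [h1, Real.norm_of_nonneg (by have := hr.1; positivity)]
  exact mul_le_of_le_one_left (by positivity) hk

theorem succ (hc : SummableOnUnitBall c) : SummableOnUnitBall fun k => c (k + 1) := by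
  intro r hr
  have h := ((summable_nat_add_iff 1).2 (hc r hr)).mul_left r⁻¹
  refine h.congr fun k => ?_
  have := hr.1.ne'
  field_simp
  ring

theorem derivCoeff (hc : SummableOnUnitBall c) :
    SummableOnUnitBall fun k => ((k : ℝ) + 1) * c (k + 1) := by
  simpa using hc.natCast_mul.succ

theorem hasDerivAt_tsum (hc : SummableOnUnitBall c) {x : ℝ} (hx : |x| < 1) :
    HasDerivAt (fun y => ∑' k, c k * y ^ k) (∑' k : ℕ, ((k : ℝ) + 1) * c (k + 1) * x ^ k) x := by
  obtain ⟨r, hr, hr1⟩ := exists_between hx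
  have hr0 : 0 < r := (abs_nonneg x).trans_lt hr
  have hsum : Summable fun k : ℕ => |(k : ℝ) * c k| * r ^ k * r⁻¹ :=
    (hc.natCast_mul r ⟨hr0, hr1⟩).mul_right _
  have h := hasDerivAt_tsum_of_isPreconnected (𝕜 := ℝ) (F := ℝ) (g := fun k y => c k * y ^ k)
    (g' := fun k y => c k * (k * y ^ (k - 1))) (t := Set.Ioo (-r) r) (y₀ := 0) (y := x)
    hsum isOpen_Ioo isPreconnected_Ioo
    (fun k y _ => (hasDerivAt_pow k y).const_mul (c k)) ?_ ⟨by linarith, hr0⟩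
    (hc.summable (by simp)) (abs_lt.1 hr)
  · refine h.congr_deriv ?_
    have hs : Summable fun k : ℕ => c k * (k * x ^ (k - 1)) := by
      rw [← summable_nat_add_iff 1]
      refine (hc.derivCoeff.summable hx).congr fun k => ?_
      simp only [Nat.add_sub_cancel, Nat.cast_add, Nat.cast_one]
      ring
    rw [hs.tsum_eq_zero_add]
    simp only [CharP.cast_eq_zero, zero_mul, mul_zero, zero_add, Nat.add_sub_cancel]
    refine tsum_congr fun k => ?_
    push_cast
    ring
  · intro k y hy
    have hy' : |y| ≤ r := (abs_lt.2 hy).le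
    rcases k with _ | k
    · simp
    · have h2 : |((k + 1 : ℕ) : ℝ) * c (k + 1)| * r ^ (k + 1) * r⁻¹
          = |((k + 1 : ℕ) : ℝ) * c (k + 1)| * r ^ k := by
        field_simp
        ring
      rw [h2, ← mul_assoc, mul_comm (c _), norm_mul, norm_pow, Real.norm_eq_abs,
        Real.norm_eq_abs, Nat.add_sub_cancel]
      gcongr

theorem contDiffOn_tsum (hc : SummableOnUnitBall c) (m : ℕ) :
    ContDiffOn ℝ m (fun y => ∑' k, c k * y ^ k) (Set.Ioo (-1) 1) := by
  induction m generalizing c with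
  | zero =>
    exact contDiffOn_zero.2 fun x hx =>
      (hc.hasDerivAt_tsum (abs_lt.2 hx)).continuousAt.continuousWithinAt
  | succ m ih =>
    push_cast
    rw [contDiffOn_succ_iff_deriv_of_isOpen isOpen_Ioo]
    refine ⟨fun x hx =>
      (hc.hasDerivAt_tsum (abs_lt.2 hx)).differentiableAt.differentiableWithinAt, by simp, ?_⟩
    exact (ih hc.derivCoeff).congr fun x hx => (hc.hasDerivAt_tsum (abs_lt.2 hx)).deriv

end SummableOnUnitBall

end PowerSeries

section Hypergeometric

/-- Taylor coefficients at `0` of the solution with value `1` at `0` of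
`x(1-x)F'' + (a/2+1)(1-2x)F' + (μ-a)F = 0`. -/
noncomputable def hyperCoeff (a μ : ℝ) : ℕ → ℝ
  | 0 => 1
  | k + 1 => hyperCoeff a μ k * (((k + 1) * (k + a) - μ) / ((k + 1) * (k + a / 2 + 1)))

/-- The solution of the hypergeometric equation with coefficients `hyperCoeff a μ`. -/
noncomputable def hyperFun (a μ x : ℝ) : ℝ := ∑' k, hyperCoeff a μ k * x ^ k

/-- Coefficients of the primitive of `hyperFun a μ` vanishing at `0`. -/
noncomputable def primCoeff (a μ : ℝ) : ℕ → ℝ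
  | 0 => 0
  | k + 1 => hyperCoeff a μ k / (k + 1)

/-- The primitive of `hyperFun a μ` vanishing at `0`. -/
noncomputable def hyperPrim (a μ x : ℝ) : ℝ := ∑' k, primCoeff a μ k * x ^ k

variable {a μ : ℝ}

theorem hyperCoeff_zero_pos (ha : 0 < a) (k : ℕ) : 0 < hyperCoeff a 0 k := by
  induction k with
  | zero => simp [hyperCoeff]
  | succ k ih =>
    rw [hyperCoeff, sub_zero]
    positivity

theorem hyperCoeff_mem_Icc (ha : 0 < a) (hμ : μ ∈ Set.Icc 0 a) (k : ℕ) :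
    hyperCoeff a μ k ∈ Set.Icc 0 (hyperCoeff a 0 k) := by
  induction k with
  | zero => simp [hyperCoeff]
  | succ k ih =>
    obtain ⟨hμ0, hμa⟩ := hμ
    have h1 : 0 ≤ ((k : ℝ) + 1) * (k + a) - μ := by
      have : (0 : ℝ) ≤ k := k.cast_nonneg
      nlinarith [mul_nonneg this ha.le]
    have h2 := ih.1
    have h3 := ih.2
    have h4 := h2.trans h3
    rw [hyperCoeff, hyperCoeff]
    refine ⟨by positivity, ?_⟩
    gcongr

theorem summableOnUnitBall_hyperCoeff_zero (ha : 0 < a) :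
    SummableOnUnitBall (hyperCoeff a 0) := by
  intro r hr
  refine summable_of_ratio_test_tendsto_lt_one hr.2 ?_ ?_
  · exact Eventually.of_forall fun k =>
      (mul_pos (abs_pos.2 (hyperCoeff_zero_pos ha k).ne') (pow_pos hr.1 k)).ne'
  · have hlim : Tendsto (fun k : ℕ => (a + 1 * (k : ℝ)) / (a / 2 + 1 + 1 * k) * r) atTop
        (nhds (1 / 1 * r)) :=
      (tendsto_add_mul_div_add_mul_atTop_nhds a (a / 2 + 1) 1 one_ne_zero).mul_const r
    rw [div_one, one_mul] at hlim
    refine hlim.congr fun k => ?_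
    have h0 := hyperCoeff_zero_pos ha k
    have h1 := hyperCoeff_zero_pos ha (k + 1)
    have hr0 := hr.1
    rw [abs_of_pos h0, abs_of_pos h1, Real.norm_of_nonneg (by positivity),
      Real.norm_of_nonneg (by positivity), hyperCoeff]
    have h2 : (k : ℝ) + 1 ≠ 0 := by positivity
    have h3 : (k : ℝ) + a / 2 + 1 ≠ 0 := by positivity
    have h4 : a / 2 + 1 + 1 * (k : ℝ) ≠ 0 := by positivity
    field_simp
    ring

theorem summableOnUnitBall_hyperCoeff (ha : 0 < a) (hμ : μ ∈ Set.Icc 0 a) :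
    SummableOnUnitBall (hyperCoeff a μ) := by
  intro r hr
  have hr0 := hr.1
  refine (summableOnUnitBall_hyperCoeff_zero ha r hr).of_nonneg_of_le
    (fun k => by positivity) fun k => ?_
  have h := hyperCoeff_mem_Icc ha hμ k
  rw [abs_of_nonneg h.1, abs_of_pos (hyperCoeff_zero_pos ha k)]
  gcongr
  exact h.2

theorem summableOnUnitBall_primCoeff (ha : 0 < a) (hμ : μ ∈ Set.Icc 0 a) :
    SummableOnUnitBall (primCoeff a μ) := by
  intro r hr
  have hr0 := hr.1
  rw [← summable_nat_add_iff 1]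
  refine ((summableOnUnitBall_hyperCoeff ha hμ r hr).mul_right r).of_nonneg_of_le
    (fun k => by positivity) fun k => ?_
  rw [primCoeff, abs_div, pow_succ, ← mul_assoc]
  gcongr
  refine div_le_self (abs_nonneg _) ?_
  rw [abs_of_pos (by positivity)]
  linarith [(k.cast_nonneg : (0 : ℝ) ≤ k)]

theorem hasDerivAt_hyperPrim (ha : 0 < a) (hμ : μ ∈ Set.Icc 0 a) {x : ℝ} (hx : |x| < 1) :
    HasDerivAt (hyperPrim a μ) (hyperFun a μ x) x := by
  refine ((summableOnUnitBall_primCoeff ha hμ).hasDerivAt_tsum hx).congr_deriv ?_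
  refine tsum_congr fun k => ?_
  have h : (k : ℝ) + 1 ≠ 0 := by positivity
  rw [primCoeff]
  field_simp

theorem hasDerivAt_hyperFun (ha : 0 < a) (hμ : μ ∈ Set.Icc 0 a) {x : ℝ} (hx : |x| < 1) :
    HasDerivAt (hyperFun a μ) (deriv (hyperFun a μ) x) x :=
  ((summableOnUnitBall_hyperCoeff ha hμ).hasDerivAt_tsum hx).differentiableAt.hasDerivAt

theorem hyperFun_flux (ha : 0 < a) (hμ : μ ∈ Set.Icc 0 a) {x : ℝ} (hx : |x| < 1) :
    a * (1 - 2 * x) * hyperFun a μ x + 2 * x * (1 - x) * deriv (hyperFun a μ) x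
      = a - 2 * μ * hyperPrim a μ x := by
  have hc := summableOnUnitBall_hyperCoeff ha hμ
  have hF := (hc.summable hx).hasSum
  have hF' := (hc.derivCoeff.summable hx).hasSum
  have hH := ((summableOnUnitBall_primCoeff ha hμ).summable hx).hasSum
  have hd : deriv (hyperFun a μ) x = ∑' k : ℕ, ((k : ℝ) + 1) * hyperCoeff a μ (k + 1) * x ^ k :=
    (hc.hasDerivAt_tsum hx).deriv
  have hxF' : HasSum (fun k : ℕ => (k : ℝ) * hyperCoeff a μ k * x ^ k)
      (x * deriv (hyperFun a μ) x) := by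
    rw [hd, ← hasSum_nat_add_iff' 1]
    simp only [Finset.range_one, Finset.sum_singleton, CharP.cast_eq_zero, zero_mul, sub_zero]
    refine (hF'.mul_left x).congr_fun ?_
    intro k
    push_cast
    ring
  have hA : HasSum (fun k : ℕ => (2 * k + a) * hyperCoeff a μ k * x ^ k)
      (2 * (x * deriv (hyperFun a μ) x) + a * hyperFun a μ x) := by
    refine ((hxF'.mul_left 2).add (hF.mul_left a)).congr_fun fun k => ?_
    ring
  have hB : HasSum (fun k : ℕ => 2 * (k + a) * hyperCoeff a μ k * x ^ (k + 1))
      (2 * x * (x * deriv (hyperFun a μ) x) + 2 * a * x * hyperFun a μ x) := by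
    refine ((hxF'.mul_left (2 * x)).add (hF.mul_left (2 * a * x))).congr_fun fun k => ?_
    ring
  have hA1 := (hasSum_nat_add_iff' 1).2 hA
  have hH1 := (hasSum_nat_add_iff' 1).2 hH
  have hC := (hB.sub (hH1.mul_left (2 * μ))).unique (hA1.congr_fun fun k => ?_)
  · have h0 : primCoeff a μ 0 = 0 := rfl
    have h1 : hyperCoeff a μ 0 = 1 := rfl
    simp only [Finset.range_one, Finset.sum_singleton, CharP.cast_eq_zero, h0, h1,
      pow_zero] at hC
    rw [hyperPrim]
    linarith
  · have h1 : (k : ℝ) + 1 ≠ 0 := by positivity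
    have h2 : (k : ℝ) + a / 2 + 1 ≠ 0 := by positivity
    rw [primCoeff, hyperCoeff]
    push_cast
    field_simp
    ring

theorem hyperPrim_self (x : ℝ) : hyperPrim a a x = x := by
  have h : ∀ k, hyperCoeff a a (k + 1) = 0 := by
    intro k
    induction k with
    | zero => simp [hyperCoeff]
    | succ k ih => rw [hyperCoeff, ih, zero_mul]
  rw [hyperPrim, tsum_eq_single 1]
  · simp [primCoeff, hyperCoeff]
  · rintro (_ | _ | k) hk
    · simp [primCoeff]
    · exact absurd rfl hk
    · rw [primCoeff, h, zero_div, zero_mul]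

theorem continuousOn_hyperPrim (ha : 0 < a) {x : ℝ} (hx : |x| < 1) :
    ContinuousOn (fun μ => hyperPrim a μ x) (Set.Icc 0 a) := by
  have hcont : ∀ k, Continuous fun μ => hyperCoeff a μ k := by
    intro k
    induction k with
    | zero => simpa [hyperCoeff] using continuous_const
    | succ k ih =>
      simp only [hyperCoeff]
      fun_prop
  have hz := (summableOnUnitBall_primCoeff ha (left_mem_Icc.2 ha.le)).summable
    (x := |x|) (by rwa [abs_abs])
  refine continuousOn_tsum (fun k => ?_) hz fun k μ hμ => ?_
  · rcases k with _ | k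
    · simpa [primCoeff] using continuousOn_const
    · simp only [primCoeff]
      have := hcont k
      fun_prop
  · rw [norm_mul, norm_pow, Real.norm_eq_abs, Real.norm_eq_abs]
    gcongr
    rcases k with _ | k
    · simp [primCoeff]
    · have h := hyperCoeff_mem_Icc ha hμ k
      rw [primCoeff, primCoeff, abs_of_nonneg (div_nonneg h.1 (by positivity))]
      gcongr
      exact h.2

end Hypergeometric

section Shooting

theorem abs_half_one_sub_cos_lt_one {θ : ℝ} (hθ : |θ| < π) : |(1 - cos θ) / 2| < 1 := by
  have h1 : -1 < cos θ := by
    rw [← cos_abs, ← cos_pi]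
    exact cos_lt_cos_of_nonneg_of_le_pi (abs_nonneg θ) le_rfl hθ
  rw [abs_lt]
  constructor <;> linarith [cos_le_one θ]

theorem exists_contDiff_eqOn_hyperFun_comp {a μ θ₀ : ℝ} (ha : 0 < a) (hμ : μ ∈ Set.Icc 0 a)
    (hθ₀ : θ₀ ∈ Set.Ioo 0 π) :
    ∃ V : ℝ → ℝ, ContDiff ℝ (⊤ : ℕ∞) V ∧ ∃ θ₁ ∈ Set.Ioo θ₀ π,
      ∀ θ ∈ Set.Ioo (-θ₁) θ₁, V θ = hyperFun a μ ((1 - cos θ) / 2) := by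
  obtain ⟨θ₁, h1, h2⟩ := exists_between hθ₀.2
  obtain ⟨θ₂, h3, h4⟩ := exists_between h2
  have h0 : 0 < θ₁ := hθ₀.1.trans h1
  let χ : ContDiffBump (0 : ℝ) := ⟨θ₁, θ₂, h0, h3⟩
  refine ⟨fun θ => χ θ * hyperFun a μ ((1 - cos θ) / 2), ?_, θ₁, ⟨h1, h2⟩, fun θ hθ => ?_⟩
  · rw [contDiff_iff_contDiffAt]
    intro θ
    by_cases hθ : |θ| < π
    · refine χ.contDiff.contDiffAt.mul ?_
      have hF : ContDiffAt ℝ (⊤ : ℕ∞) (hyperFun a μ) ((1 - cos θ) / 2) :=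
        (contDiffOn_infty.2 (summableOnUnitBall_hyperCoeff ha hμ).contDiffOn_tsum).contDiffAt
          (isOpen_Ioo.mem_nhds (abs_lt.1 (abs_half_one_sub_cos_lt_one hθ)))
      exact hF.comp θ
        ((contDiffAt_const.sub contDiff_cos.contDiffAt).div_const 2)
    · have hev : (fun θ => χ θ * hyperFun a μ ((1 - cos θ) / 2)) =ᶠ[nhds θ] fun _ => 0 := by
        have hopen : ∀ᶠ t in nhds θ, θ₂ < |t| :=
          continuous_abs.continuousAt.eventually (lt_mem_nhds (by linarith))
        filter_upwards [hopen] with t ht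
        rw [χ.zero_of_le_dist (by rw [Real.dist_0_eq_abs]; exact ht.le), zero_mul]
      exact contDiffAt_const.congr_of_eventuallyEq hev
  · have hone : χ θ = 1 := by
      apply χ.one_of_mem_closedBall
      rw [mem_closedBall_zero_iff]
      exact (abs_lt.2 hθ).le
    simp only [hone, one_mul]

theorem isEigenvalue_of_hyperPrim {n : ℕ} {s θ₀ μ : ℝ} (ha : 0 < 2 * s - (n : ℝ))
    (hμ : μ ∈ Set.Icc 0 (2 * s - (n : ℝ))) (hθ₀ : θ₀ ∈ Set.Ioo 0 π)
    (h : 2 * s - (n : ℝ) - 2 * μ * hyperPrim (2 * s - n) μ ((1 - cos θ₀) / 2) = 0) :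
    IsEigenvalue n s θ₀ ((s - 1) * (s - (n : ℝ)) + μ) := by
  obtain ⟨V, hV, θ₁, hθ₁, hVF⟩ := exists_contDiff_eqOn_hyperFun_comp ha hμ hθ₀
  set a : ℝ := 2 * s - (n : ℝ)
  have hmem : ∀ t ∈ Set.Ioc 0 θ₀, t ∈ Set.Ioo (-θ₁) θ₁ := fun t ht =>
    ⟨by linarith [ht.1, hθ₁.1, hθ₀.1], ht.2.trans_lt hθ₁.1⟩
  have hball : ∀ t ∈ Set.Ioo (-θ₁) θ₁, |(1 - cos t) / 2| < 1 := fun t ht =>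
    abs_half_one_sub_cos_lt_one ((abs_lt.2 ht).trans hθ₁.2)
  have hsin : ∀ t ∈ Set.Ioc 0 θ₀, 0 < sin t := fun t ht =>
    sin_pos_of_pos_of_lt_pi ht.1 (ht.2.trans_lt hθ₀.2)
  have hx : ∀ t, HasDerivAt (fun t => (1 - cos t) / 2) (sin t / 2) t := fun t => by
    simpa using ((hasDerivAt_cos t).const_sub 1).div_const 2
  have hVd : ∀ t, HasDerivAt V (deriv V t) t := fun t =>
    (hV.differentiable (by simp) t).hasDerivAt
  have hflux : ∀ t ∈ Set.Ioo (-θ₁) θ₁,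
      a * cos t * V t + sin t * deriv V t = a - 2 * μ * hyperPrim a μ ((1 - cos t) / 2) := by
    intro t ht
    have hev : V =ᶠ[nhds t] fun θ => hyperFun a μ ((1 - cos θ) / 2) := by
      filter_upwards [Ioo_mem_nhds ht.1 ht.2] with θ hθ using hVF θ hθ
    have hd := (HasDerivAt.comp t (hasDerivAt_hyperFun ha hμ (hball t ht)) (hx t)).deriv
    rw [hev.deriv_eq, hVF t ht, ← hyperFun_flux ha hμ (hball t ht)]
    simp only [Function.comp_def] at hd
    rw [hd]
    linear_combination
      (deriv (hyperFun a μ) ((1 - cos t) / 2) / 2) * sin_sq_add_cos_sq t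
  refine ⟨V, hV, ⟨0, ⟨le_rfl, hθ₀.1.le⟩, ?_⟩, fun θ hθ => ?_, ?_⟩
  · rw [hVF 0 ⟨by linarith [hθ₁.1, hθ₀.1], hθ₀.1.trans hθ₁.1⟩, cos_zero, sub_self, zero_div,
      hyperFun, tsum_eq_single 0]
    · simp [hyperCoeff]
    · intro k hk
      simp [hk]
  · have hθ' : θ ∈ Set.Ioc 0 θ₀ := ⟨hθ.1, hθ.2.le⟩
    have h0 := hsin θ hθ'
    have hm := hmem θ hθ'
    have hp : HasDerivAt (fun t => a * cos t * V t + sin t * deriv V t)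
        (-(2 * μ * (hyperFun a μ ((1 - cos θ) / 2) * (sin θ / 2)))) θ := by
      refine HasDerivAt.congr_of_eventuallyEq (((HasDerivAt.comp θ
        (hasDerivAt_hyperPrim ha hμ (hball θ hm)) (hx θ)).const_mul (2 * μ)).const_sub a) ?_
      filter_upwards [Ioo_mem_nhds hm.1 hm.2] with t ht using hflux t ht
    rw [Ls_sin_rpow_mul h0 (Eventually.of_forall hVd) hp, hVF θ hm, rpow_sub_one h0.ne']
    field_simp
    ring
  · have hm : θ₀ ∈ Set.Ioc 0 θ₀ := ⟨hθ₀.1, le_rfl⟩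
    rw [(hasDerivAt_sin_rpow_mul_s6 (hsin θ₀ hm) (hVd θ₀)).deriv, hflux θ₀ (hmem θ₀ hm), h,
      mul_zero]

theorem exists_isEigenvalue_lt {n : ℕ} {s θ₀ : ℝ} (hs : (n : ℝ) / 2 < s)
    (hθ₀ : θ₀ ∈ Set.Ioo (π / 2) π) :
    ∃ lam, IsEigenvalue n s θ₀ lam ∧ lam < s * (s + 1 - (n : ℝ)) := by
  have ha : 0 < 2 * s - (n : ℝ) := by linarith
  have hθ₀' : θ₀ ∈ Set.Ioo 0 π := ⟨by linarith [pi_pos, hθ₀.1], hθ₀.2⟩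
  have hcos : cos θ₀ < 0 :=
    cos_neg_of_pi_div_two_lt_of_lt hθ₀.1 (by linarith [pi_pos, hθ₀.2])
  have hx := abs_half_one_sub_cos_lt_one (θ := θ₀) (by rw [abs_of_pos hθ₀'.1]; exact hθ₀.2)
  have hend : 2 * s - (n : ℝ) - 2 * (2 * s - n) *
      hyperPrim (2 * s - n) (2 * s - n) ((1 - cos θ₀) / 2) < 0 := by
    rw [hyperPrim_self]
    nlinarith
  have hcont : ContinuousOn (fun μ => 2 * s - (n : ℝ) - 2 * μ *
      hyperPrim (2 * s - n) μ ((1 - cos θ₀) / 2)) (Set.Icc 0 (2 * s - (n : ℝ))) := by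
    have := continuousOn_hyperPrim ha hx
    fun_prop
  obtain ⟨μ, hμ, hμ0⟩ := intermediate_value_Icc' ha.le hcont
    (show (0 : ℝ) ∈ Set.Icc _ _ from ⟨hend.le, by simpa using ha.le⟩)
  have hlt : μ < 2 * s - (n : ℝ) := by
    refine lt_of_le_of_ne hμ.2 ?_
    rintro rfl
    exact hend.ne hμ0
  exact ⟨_, isEigenvalue_of_hyperPrim ha hμ hθ₀' hμ0, by linarith⟩

end Shooting

/-- for `θ₀ ∈ (π/2, π)`, the lowest eigenvalue `λ₀` of `L_s` on
`[0, θ₀]` satisfies `(s-1)(s-n) < λ₀ < s(s+1-n)`. -/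
theorem stmt_6 (n : ℕ) (hn : 2 ≤ n) (s : ℝ) (hs : (n : ℝ) / 2 < s)
    (θ₀ : ℝ) (hθ₀ : θ₀ ∈ Set.Ioo (Real.pi / 2) Real.pi)
    (lam₀ : ℝ) (hlam₀ : IsEigenvalue n s θ₀ lam₀)
    (hmin : ∀ lam : ℝ, IsEigenvalue n s θ₀ lam → lam₀ ≤ lam) :
    (s - 1) * (s - (n : ℝ)) < lam₀ ∧ lam₀ < s * (s + 1 - (n : ℝ)) := by
  have hθ₀' : θ₀ ∈ Set.Ioo 0 π := ⟨by linarith [pi_pos, hθ₀.1], hθ₀.2⟩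
  obtain ⟨lam, hlam, hlt⟩ := exists_isEigenvalue_lt hs hθ₀
  exact ⟨sub_lt_of_isEigenvalue hs hθ₀' hlam₀, (hmin lam hlam).trans_lt hlt⟩
end

section
/- Let n ≥ 2 be an integer, s > n/2 a real number, and ν ∈ ℝ. Let v ∈ C²((−1, 1)) and define u(θ) = sin(θ)^{2s−n}·v(cos θ) for θ ∈ (0, π). Then L_s u = ν(ν + 1 − n)·u holds on (0, π) if and only if v satisfies the Gegenbauer-type equation (1 − x²)·v''(x) − (2s − n + 2)·x·v'(x) + [ν(ν + 1 − n) − s(s + 1 − n)]·v(x) = 0 on (−1, 1). -/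
open Real Set Filter

lemma cos_mem_Ioo_neg_one_one {θ : ℝ} (hθ : θ ∈ Set.Ioo 0 Real.pi) :
    Real.cos θ ∈ Set.Ioo (-1 : ℝ) 1 := by
  have := Real.sin_pos_of_mem_Ioo hθ
  constructor <;> nlinarith [Real.sin_sq_add_cos_sq θ]

lemma hasDerivAt_sin_rpow (a : ℝ) {θ : ℝ} (hθ : θ ∈ Set.Ioo 0 Real.pi) :
    HasDerivAt (fun t => Real.sin t ^ a) (Real.sin θ ^ a * (a * Real.cos θ / Real.sin θ)) θ := by
  have hS := (Real.sin_pos_of_mem_Ioo hθ).ne'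
  convert (Real.hasDerivAt_sin θ).rpow_const (p := a) (Or.inl hS) using 1
  rw [Real.rpow_sub_one hS]
  ring

lemma hasDerivAt_sin_rpow_mul_comp_cos (a : ℝ) {v : ℝ → ℝ} {θ : ℝ} (hθ : θ ∈ Set.Ioo 0 Real.pi)
    (hv : DifferentiableAt ℝ v (Real.cos θ)) :
    HasDerivAt (fun t => Real.sin t ^ a * v (Real.cos t))
      (Real.sin θ ^ a * (a * Real.cos θ / Real.sin θ * v (Real.cos θ)
        - Real.sin θ * deriv v (Real.cos θ))) θ := by
  refine ((hasDerivAt_sin_rpow a hθ).mul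
    (hv.hasDerivAt.comp θ (Real.hasDerivAt_cos θ))).congr_deriv ?_
  simp only [Function.comp_apply]
  ring

lemma Ls_sin_rpow_mul_comp_cos (n : ℕ) (s : ℝ) {v : ℝ → ℝ}
    (hv : ContDiffOn ℝ 2 v (Set.Ioo (-1) 1)) {θ : ℝ} (hθ : θ ∈ Set.Ioo 0 Real.pi) :
    Ls n s (fun t => Real.sin t ^ (2 * s - (n : ℝ)) * v (Real.cos t)) θ
      = -Real.sin θ ^ (2 * s - (n : ℝ)) *
        ((1 - Real.cos θ ^ 2) * deriv (deriv v) (Real.cos θ)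
          - (2 * s - (n : ℝ) + 2) * Real.cos θ * deriv v (Real.cos θ)
          - s * (s + 1 - (n : ℝ)) * v (Real.cos θ)) := by
  have hv1 : ∀ t ∈ Set.Ioo 0 Real.pi, DifferentiableAt ℝ v (Real.cos t) := fun t ht =>
    (hv.differentiableOn two_ne_zero).differentiableAt
      (isOpen_Ioo.mem_nhds (cos_mem_Ioo_neg_one_one ht))
  have hv2 : DifferentiableAt ℝ (deriv v) (Real.cos θ) :=
    ((hv.deriv_of_isOpen (m := 1) isOpen_Ioo (by norm_num)).differentiableOn
      one_ne_zero).differentiableAt (isOpen_Ioo.mem_nhds (cos_mem_Ioo_neg_one_one hθ))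
  have hS := (Real.sin_pos_of_mem_Ioo hθ).ne'
  have hcomp := (hv1 θ hθ).hasDerivAt.comp θ (Real.hasDerivAt_cos θ)
  have hcomp' := hv2.hasDerivAt.comp θ (Real.hasDerivAt_cos θ)
  have hd : deriv (fun t => Real.sin t ^ (2 * s - (n : ℝ)) * v (Real.cos t)) =ᶠ[nhds θ]
      fun t => Real.sin t ^ (2 * s - (n : ℝ)) *
        ((2 * s - (n : ℝ)) * Real.cos t / Real.sin t * v (Real.cos t)
          - Real.sin t * deriv v (Real.cos t)) := by
    filter_upwards [isOpen_Ioo.mem_nhds hθ] with t ht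
    exact (hasDerivAt_sin_rpow_mul_comp_cos _ ht (hv1 t ht)).deriv
  have hdd := (hasDerivAt_sin_rpow (2 * s - (n : ℝ)) hθ).mul
    (((((Real.hasDerivAt_cos θ).const_mul (2 * s - (n : ℝ))).div (Real.hasDerivAt_sin θ) hS).mul
      hcomp).sub ((Real.hasDerivAt_sin θ).mul hcomp'))
  have hdd' := hd.deriv_eq.trans hdd.deriv
  rw [Ls, hdd', hd.eq_of_nhds, Real.cot_eq_cos_div_sin]
  simp only [Function.comp_apply, Pi.mul_apply, Pi.sub_apply, Pi.div_apply]
  rw [← Real.sin_sq]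
  field_simp
  have hC := Real.cos_sq' θ
  grind

/-- `u(θ) = sin(θ)^{2s-n} v(cos θ)` satisfies `L_s u = ν(ν+1-n) u`
on `(0,π)` iff `v` satisfies the Gegenbauer-type equation on `(-1,1)`. -/
theorem stmt_9 (n : ℕ) (hn : 2 ≤ n) (s : ℝ) (hs : (n : ℝ) / 2 < s) (ν : ℝ)
    (v : ℝ → ℝ) (hv : ContDiffOn ℝ 2 v (Set.Ioo (-1) 1)) :
    (∀ θ ∈ Set.Ioo 0 Real.pi,
      Ls n s (fun t => Real.sin t ^ (2 * s - (n : ℝ)) * v (Real.cos t)) θ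
        = ν * (ν + 1 - (n : ℝ))
          * (Real.sin θ ^ (2 * s - (n : ℝ)) * v (Real.cos θ)))
    ↔ (∀ x ∈ Set.Ioo (-1 : ℝ) 1,
      (1 - x ^ 2) * deriv (deriv v) x - (2 * s - (n : ℝ) + 2) * x * deriv v x
        + (ν * (ν + 1 - (n : ℝ)) - s * (s + 1 - (n : ℝ))) * v x = 0) := by
  have key : ∀ θ ∈ Set.Ioo 0 Real.pi,
      (Ls n s (fun t => Real.sin t ^ (2 * s - (n : ℝ)) * v (Real.cos t)) θ
        = ν * (ν + 1 - (n : ℝ))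
          * (Real.sin θ ^ (2 * s - (n : ℝ)) * v (Real.cos θ))) ↔
      ((1 - Real.cos θ ^ 2) * deriv (deriv v) (Real.cos θ)
        - (2 * s - (n : ℝ) + 2) * Real.cos θ * deriv v (Real.cos θ)
        + (ν * (ν + 1 - (n : ℝ)) - s * (s + 1 - (n : ℝ))) * v (Real.cos θ) = 0) := by
    intro θ hθ
    have hS := (Real.rpow_pos_of_pos (Real.sin_pos_of_mem_Ioo hθ) (2 * s - (n : ℝ))).ne'
    rw [Ls_sin_rpow_mul_comp_cos n s hv hθ]
    constructor
    · intro h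
      apply mul_left_cancel₀ hS
      linear_combination -h
    · intro h
      linear_combination -Real.sin θ ^ (2 * s - (n : ℝ)) * h
  constructor
  · intro h x hx
    have hθ : Real.arccos x ∈ Set.Ioo 0 Real.pi :=
      ⟨Real.arccos_pos.2 hx.2, (Real.arccos_lt_pi).2 hx.1⟩
    simpa only [Real.cos_arccos hx.1.le hx.2.le] using (key _ hθ).1 (h _ hθ)
  · intro h θ hθ
    exact (key θ hθ).2 (h _ (cos_mem_Ioo_neg_one_one hθ))
end

section
/- Let n ≥ 2 be an integer, s > n/2 a real number, and k ≥ 0 an integer. There exists a nonzero even polynomial p of degree 2k such that the function u(θ) = sin(θ)^{2s−n}·p(cos θ) satisfies L_s u = (s + 2k)(s + 2k + 1 − n)·u on (0, π) and u'(π/2) = 0. -/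
open Real Set Filter

open Polynomial in
/-- Coefficient of `X ^ (2 * m)` in the even polynomial solution of the Gegenbauer equation
`(1 - x²) p'' - (a + 2) x p' + 2k (2k + a + 1) p = 0` normalised by `p(0) = 1`. -/
noncomputable def gegenbauerCoeff (a : ℝ) (k : ℕ) : ℕ → ℝ
  | 0 => 1
  | m + 1 => (2 * m - 2 * k) * (2 * m + 2 * k + a + 1) / ((2 * m + 2) * (2 * m + 1))
      * gegenbauerCoeff a k m

open Polynomial in
/-- The truncation at degree `2 * K` of the even power series solution of the Gegenbauer
equation. -/
noncomputable def evenGegenbauer (a : ℝ) (k K : ℕ) : ℝ[X] :=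
  ∑ m ∈ Finset.range (K + 1), C (gegenbauerCoeff a k m) * X ^ (2 * m)

lemma gegenbauerCoeff_ne_zero {a : ℝ} (ha : 0 < a) {k m : ℕ} (hm : m ≤ k) :
    gegenbauerCoeff a k m ≠ 0 := by
  induction m with
  | zero => simp [gegenbauerCoeff]
  | succ m ih =>
    have h1 : (m : ℝ) < k := by exact_mod_cast hm
    have h2 : (2 * m - 2 * k : ℝ) ≠ 0 := by linarith
    have h3 : (2 * m + 2 * k + a + 1 : ℝ) ≠ 0 := by positivity
    have h4 : ((2 * m + 2) * (2 * m + 1) : ℝ) ≠ 0 := by positivity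
    exact mul_ne_zero (div_ne_zero (mul_ne_zero h2 h3) h4) (ih (by omega))

lemma evenGegenbauer_succ (a : ℝ) (k K : ℕ) :
    evenGegenbauer a k (K + 1) = evenGegenbauer a k K
      + Polynomial.C (gegenbauerCoeff a k (K + 1)) * Polynomial.X ^ (2 * K + 2) :=
  Finset.sum_range_succ _ _

lemma evenGegenbauer_natDegree_le (a : ℝ) (k K : ℕ) :
    (evenGegenbauer a k K).natDegree ≤ 2 * K := by
  refine Polynomial.natDegree_sum_le_of_forall_le _ _ fun m hm => ?_
  have := Finset.mem_range.1 hm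
  exact (Polynomial.natDegree_C_mul_X_pow_le _ _).trans (by omega)

lemma evenGegenbauer_coeff (a : ℝ) (k K : ℕ) :
    (evenGegenbauer a k K).coeff (2 * K) = gegenbauerCoeff a k K := by
  simp [evenGegenbauer, Polynomial.finsetSum_coeff, Polynomial.coeff_X_pow]

lemma evenGegenbauer_eval_neg (a : ℝ) (k K : ℕ) (x : ℝ) :
    (evenGegenbauer a k K).eval (-x) = (evenGegenbauer a k K).eval x := by
  simp [evenGegenbauer, Polynomial.eval_finsetSum, pow_mul]

lemma evenGegenbauer_derivative_eval_zero (a : ℝ) (k K : ℕ) :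
    (evenGegenbauer a k K).derivative.eval 0 = 0 := by
  induction K with
  | zero => simp [evenGegenbauer]
  | succ K ih => rw [evenGegenbauer_succ]; simp [ih]

/-- The truncation solves the Gegenbauer equation up to its top-degree term. -/
lemma evenGegenbauer_ode (a : ℝ) (k K : ℕ) (x : ℝ) :
    (1 - x ^ 2) * (evenGegenbauer a k K).derivative.derivative.eval x
      - (a + 2) * x * (evenGegenbauer a k K).derivative.eval x
      + 2 * k * (2 * k + a + 1) * (evenGegenbauer a k K).eval x
      = (2 * k - 2 * K) * (2 * K + 2 * k + a + 1) * gegenbauerCoeff a k K * x ^ (2 * K) := by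
  induction K with
  | zero => simp [evenGegenbauer, gegenbauerCoeff]
  | succ K ih =>
    have hc : (2 * K + 2) * (2 * K + 1) * gegenbauerCoeff a k (K + 1)
        = (2 * K - 2 * k) * (2 * K + 2 * k + a + 1) * gegenbauerCoeff a k K := by
      rw [gegenbauerCoeff]; field_simp
    rw [evenGegenbauer_succ]
    simp only [Polynomial.derivative_add, Polynomial.eval_add, Polynomial.derivative_C_mul,
      Polynomial.derivative_X_pow, Polynomial.eval_mul, Polynomial.eval_C, Polynomial.eval_pow,
      Polynomial.eval_X, Nat.add_sub_cancel, Nat.add_succ_sub_one]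
    push_cast
    linear_combination ih + x ^ (2 * K) * hc

lemma hasDerivAt_sin_rpow_mul_eval_cos (a : ℝ) (p : Polynomial ℝ) {θ : ℝ} (hθ : 0 < sin θ) :
    HasDerivAt (fun t => sin t ^ a * p.eval (cos t))
      (a * (sin θ ^ (a - 1) * (Polynomial.X * p).eval (cos θ))
        - sin θ ^ (a + 1) * p.derivative.eval (cos θ)) θ := by
  have h1 := (hasDerivAt_sin θ).rpow_const (p := a) (Or.inl hθ.ne')
  have h2 := (p.hasDerivAt (cos θ)).comp θ (hasDerivAt_cos θ)
  refine (h1.mul h2).congr_deriv ?_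
  simp only [Polynomial.eval_mul, Polynomial.eval_X, rpow_add_one hθ.ne', Function.comp_apply]
  ring

lemma Ls_sin_rpow_mul_eval_cos (n : ℕ) (s : ℝ) (p : Polynomial ℝ) {θ : ℝ}
    (hθ : θ ∈ Ioo 0 π) :
    Ls n s (fun t => sin t ^ (2 * s - n) * p.eval (cos t)) θ
      = sin θ ^ (2 * s - n) * (-((1 - cos θ ^ 2) * p.derivative.derivative.eval (cos θ))
        + (2 * s - n + 2) * cos θ * p.derivative.eval (cos θ)
        + (2 * s - n + (s - 1) * (s - n)) * p.eval (cos θ)) := by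
  have hs : 0 < sin θ := sin_pos_of_mem_Ioo hθ
  set a : ℝ := 2 * s - n with ha
  have h1 : deriv (fun t => sin t ^ a * p.eval (cos t)) =ᶠ[nhds θ] fun t =>
      a * (sin t ^ (a - 1) * (Polynomial.X * p).eval (cos t))
        - sin t ^ (a + 1) * p.derivative.eval (cos t) := by
    filter_upwards [isOpen_Ioo.mem_nhds hθ] with t ht
    exact (hasDerivAt_sin_rpow_mul_eval_cos a p (sin_pos_of_mem_Ioo ht)).deriv
  have h2 := ((hasDerivAt_sin_rpow_mul_eval_cos (a - 1) (Polynomial.X * p) hs).const_mul a).fun_sub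
    (hasDerivAt_sin_rpow_mul_eval_cos (a + 1) p.derivative hs)
  rw [Ls, h1.deriv_eq, h2.deriv, h1.eq_of_nhds, cot_eq_cos_div_sin]
  have hn : (n : ℝ) = 2 * s - a := by rw [ha]; ring
  simp only [Polynomial.eval_mul, Polynomial.eval_X, Polynomial.derivative_mul,
    Polynomial.derivative_X, Polynomial.eval_add, one_mul, sub_add_cancel, add_sub_cancel_right,
    rpow_add_one hs.ne', rpow_sub_one hs.ne']
  rw [hn, ← sin_sq]
  field_simp
  ring

/-- there is a nonzero even polynomial `p` of degree `2k` such that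
`u(θ) = sin(θ)^{2s-n} p(cos θ)` satisfies `L_s u = (s+2k)(s+2k+1-n) u` on `(0,π)`
and `u'(π/2) = 0`. -/
theorem stmt_10 (n : ℕ) (hn : 2 ≤ n) (s : ℝ) (hs : (n : ℝ) / 2 < s) (k : ℕ) :
    ∃ p : Polynomial ℝ, p ≠ 0 ∧ p.natDegree = 2 * k ∧
      (∀ x : ℝ, p.eval (-x) = p.eval x) ∧
      (∀ θ ∈ Set.Ioo 0 Real.pi,
        Ls n s (fun t => Real.sin t ^ (2 * s - (n : ℝ)) * p.eval (Real.cos t)) θ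
          = (s + 2 * (k : ℝ)) * (s + 2 * (k : ℝ) + 1 - (n : ℝ))
            * (Real.sin θ ^ (2 * s - (n : ℝ)) * p.eval (Real.cos θ))) ∧
      deriv (fun t => Real.sin t ^ (2 * s - (n : ℝ)) * p.eval (Real.cos t))
        (Real.pi / 2) = 0 := by
  have ha : 0 < 2 * s - (n : ℝ) := by linarith
  set p := evenGegenbauer (2 * s - n) k k with hp
  have hc : p.coeff (2 * k) ≠ 0 := by
    rw [hp, evenGegenbauer_coeff]
    exact gegenbauerCoeff_ne_zero ha le_rfl
  refine ⟨p, fun h => hc (by rw [h, Polynomial.coeff_zero]),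
    Polynomial.natDegree_eq_of_le_of_coeff_ne_zero (evenGegenbauer_natDegree_le _ _ _) hc,
    evenGegenbauer_eval_neg _ _ _, fun θ hθ => ?_, ?_⟩
  · rw [Ls_sin_rpow_mul_eval_cos n s p hθ]
    linear_combination
      -(sin θ ^ (2 * s - (n : ℝ))) * evenGegenbauer_ode (2 * s - n) k k (cos θ)
  · rw [(hasDerivAt_sin_rpow_mul_eval_cos _ p (by simp)).deriv]
    simp [hp, evenGegenbauer_derivative_eval_zero]
end

section
/- Let n ≥ 2 be an integer, s > n/2 a real number, ν ∈ ℝ, and θ₀ ∈ (0, π). Let p, q : (0, θ₀] → ℝ be such that P(θ) := sin(θ)^{n−s}·p(θ) and Q(θ) := sin(θ)^{n−s}·q(θ) are C² on (0, θ₀] and satisfy I_{s,ν} P = 0 = I_{s,ν} Q on (0, θ₀], with P'(θ)·Q(θ) − P(θ)·Q'(θ) = sin(θ)^{n−1} for all θ ∈ (0, θ₀]. Assume p is bounded on (0, θ₀] with p'(θ₀) = 0, and q(θ) = O(θ^{2s−n}) as θ → 0⁺. Let f be continuous on (0, θ₀] with f(θ) = O(θ^{n−s+1}) as θ → 0⁺,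 and define Gf(θ) = sin(θ)^{n−s}·p(θ)·∫₀^θ q(φ)·f(φ)/sin(φ)^{s+1} dφ + sin(θ)^{n−s}·q(θ)·∫_θ^{θ₀} p(φ)·f(φ)/sin(φ)^{s+1} dφ. Then: (i) both integrals converge for every θ ∈ (0, θ₀]; (ii) Gf is C² on (0, θ₀] and I_{s,ν}(Gf) = f on (0, θ₀]; (iii) sin(θ)^{s−n}·Gf(θ) → 0 as θ → 0⁺; and (iv) (Gf)'(θ₀) + (s − n)·cot(θ₀)·Gf(θ₀) = 0. -/
open Real MeasureTheory Set Filter Asymptotics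

/-- One-sided derivative on `(0, θ₀]`. -/
noncomputable def dW (θ₀ : ℝ) (u : ℝ → ℝ) : ℝ → ℝ := derivWithin u (Set.Ioc 0 θ₀)

/-- The indicial operator `I_{s,ν}` on `(0, θ₀]`, with derivatives taken within
`(0, θ₀]`. -/
noncomputable def IopW (n : ℕ) (s ν θ₀ : ℝ) (u : ℝ → ℝ) (θ : ℝ) : ℝ :=
  Real.sin θ ^ 2 * dW θ₀ (dW θ₀ u) θ
    + (1 - (n : ℝ)) * Real.sin θ * Real.cos θ * dW θ₀ u θ
    + ν * (ν + 1 - (n : ℝ)) * Real.sin θ ^ 2 * u θ + s * ((n : ℝ) - s) * u θ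

/-- A function continuous on `(0, T]` that is dominated by `h` near `0` is dominated by `h`
on all of `(0, T]`. -/
lemma exists_bound_Ioc_of_isBigO {T : ℝ} {g h : ℝ → ℝ} (hg : ContinuousOn g (Ioc 0 T))
    (hh : ContinuousOn h (Ioc 0 T)) (hpos : ∀ x ∈ Ioc 0 T, 0 < h x)
    (hO : g =O[nhdsWithin 0 (Ioi 0)] h) :
    ∃ C, 0 ≤ C ∧ ∀ x ∈ Ioc 0 T, |g x| ≤ C * h x := by
  obtain ⟨c, hc⟩ := hO.bound
  obtain ⟨ε, hε, hεc⟩ := mem_nhdsGT_iff_exists_Ioo_subset.1 hc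
  have hε : 0 < ε := hε
  have hsub : Icc ε T ⊆ Ioc 0 T := fun x hx => ⟨hε.trans_le hx.1, hx.2⟩
  obtain ⟨d, hd⟩ := isCompact_Icc.exists_bound_of_continuousOn
    ((hg.mono hsub).div (hh.mono hsub) fun x hx => (hpos x (hsub hx)).ne')
  refine ⟨max 0 (max c d), le_max_left _ _, fun x hx => ?_⟩
  have hx0 := hpos x hx
  rcases lt_or_ge x ε with hlt | hge
  · have h1 : ‖g x‖ ≤ c * ‖h x‖ := hεc ⟨hx.1, hlt⟩
    rw [Real.norm_eq_abs, Real.norm_eq_abs, abs_of_pos hx0] at h1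
    refine h1.trans ?_
    gcongr
    exact (le_max_left c d).trans (le_max_right _ _)
  · have h1 := hd x ⟨hge, hx.2⟩
    rw [Pi.div_apply, norm_div, Real.norm_eq_abs, Real.norm_eq_abs, abs_of_pos hx0,
      div_le_iff₀ hx0] at h1
    refine h1.trans ?_
    gcongr
    exact (le_max_right c d).trans (le_max_right _ _)

lemma hasDerivWithinAt_integral_Ioc {T c θ : ℝ} {a : ℝ → ℝ} (ha : ContinuousOn a (Ioc 0 T))
    (hθ : θ ∈ Ioc 0 T) (hi : IntervalIntegrable a volume c θ) :
    HasDerivWithinAt (fun x => ∫ t in c..x, a t) (a θ) (Ioc 0 T) θ := by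
  have hsub : Icc (θ / 2) T ⊆ Ioc 0 T := fun x hx => ⟨(half_pos hθ.1).trans_le hx.1, hx.2⟩
  have : Fact (θ ∈ Icc (θ / 2) T) := ⟨⟨by linarith [hθ.1], hθ.2⟩⟩
  have hI : HasDerivWithinAt (fun x => ∫ t in c..x, a t) (a θ) (Icc (θ / 2) T) θ :=
    intervalIntegral.integral_hasDerivWithinAt_right hi
      ((ha.mono hsub).stronglyMeasurableAtFilter_nhdsWithin measurableSet_Icc θ)
      ((ha.mono hsub) θ this.out)
  refine hI.mono_of_mem_nhdsWithin ?_
  filter_upwards [self_mem_nhdsWithin, mem_nhdsWithin_of_mem_nhds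
    (Ioi_mem_nhds (half_lt_self hθ.1))] with x hx hx'
  exact ⟨le_of_lt hx', hx.2⟩

lemma sin_isTheta_nhdsGT_zero : Real.sin =Θ[nhdsWithin 0 (Ioi 0)] fun θ : ℝ => θ := by
  constructor
  · exact IsBigO.of_bound 1 (Eventually.of_forall fun x => by
      simpa using Real.abs_sin_le_abs)
  · refine IsBigO.of_bound (π / 2) ?_
    filter_upwards [Ioo_mem_nhdsGT (half_pos Real.pi_pos)] with x hx
    have h := Real.mul_le_sin hx.1.le hx.2.le
    have h0 := Real.sin_pos_of_pos_of_lt_pi hx.1 (by linarith [hx.2, Real.pi_pos])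
    rw [Real.norm_eq_abs, Real.norm_eq_abs, abs_of_pos hx.1, abs_of_pos h0]
    calc x = π / 2 * (2 / π * x) := by field_simp
      _ ≤ π / 2 * Real.sin x := by gcongr

lemma sin_rpow_isTheta_nhdsGT_zero (r : ℝ) :
    (fun θ => Real.sin θ ^ r) =Θ[nhdsWithin 0 (Ioi 0)] fun θ : ℝ => θ ^ r := by
  refine sin_isTheta_nhdsGT_zero.rpow ?_ ?_
  · filter_upwards [Ioo_mem_nhdsGT Real.pi_pos] with x hx
    exact (Real.sin_pos_of_pos_of_lt_pi hx.1 hx.2).le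
  · filter_upwards [self_mem_nhdsWithin] with x hx
    exact le_of_lt hx

/-- If `q = O(θ^r)` and `b = O(φ^{-r})` with `r > 0`, then `q(θ) ∫_θ^T b → 0` as `θ → 0⁺`. -/
lemma tendsto_mul_setIntegral_Ioc_zero {T r Cq Cb : ℝ} (hT : 0 < T) (hr : 0 < r) {q b : ℝ → ℝ}
    (hCq : 0 ≤ Cq) (hCb : 0 ≤ Cb)
    (hb : ContinuousOn b (Ioc 0 T)) (hqB : ∀ x ∈ Ioc 0 T, |q x| ≤ Cq * x ^ r)
    (hbB : ∀ x ∈ Ioc 0 T, |b x| ≤ Cb * x ^ (-r)) :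
    Tendsto (fun θ => q θ * ∫ φ in Ioc θ T, b φ) (nhdsWithin 0 (Ioi 0)) (nhds 0) := by
  have hmem : ∀ᶠ θ in nhdsWithin (0 : ℝ) (Ioi 0), θ ∈ Ioc 0 T := Ioc_mem_nhdsGT hT
  have hq0 : Tendsto q (nhdsWithin 0 (Ioi 0)) (nhds 0) := by
    have hlim : Tendsto (fun x : ℝ => Cq * x ^ r) (nhdsWithin 0 (Ioi 0)) (nhds 0) := by
      have := (Real.continuousAt_rpow_const 0 r (Or.inr hr.le)).tendsto.const_mul Cq
      rw [Real.zero_rpow hr.ne', mul_zero] at this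
      exact this.mono_left nhdsWithin_le_nhds
    refine squeeze_zero_norm' ?_ hlim
    filter_upwards [hmem] with x hx using hqB x hx
  have hD : Tendsto (fun θ => ∫ φ in Ioc 0 T, q θ * (Ioi θ).indicator b φ)
      (nhdsWithin 0 (Ioi 0)) (nhds (∫ _ in Ioc 0 T, (0 : ℝ))) := by
    refine tendsto_integral_filter_of_dominated_convergence (fun _ => Cq * Cb) ?_ ?_ ?_ ?_
    · refine Eventually.of_forall fun θ => ?_
      exact ((hb.aestronglyMeasurable measurableSet_Ioc).indicator measurableSet_Ioi).const_mul _
    · filter_upwards [hmem] with θ hθ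
      refine (ae_restrict_iff' measurableSet_Ioc).2 (Eventually.of_forall fun φ hφ => ?_)
      by_cases h : φ ∈ Ioi θ
      · rw [indicator_of_mem h, norm_mul]
        calc ‖q θ‖ * ‖b φ‖ ≤ (Cq * θ ^ r) * (Cb * φ ^ (-r)) := by
              have := hqB θ hθ
              have := hbB φ hφ
              have := Real.rpow_nonneg hθ.1.le r
              simp only [Real.norm_eq_abs]
              gcongr
          _ ≤ (Cq * φ ^ r) * (Cb * φ ^ (-r)) := by
              have := Real.rpow_nonneg hφ.1.le (-r)
              have := hθ.1.le
              have : θ ≤ φ := le_of_lt h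
              gcongr
          _ = Cq * Cb * (φ ^ r * φ ^ (-r)) := by ring
          _ = Cq * Cb := by
              rw [← Real.rpow_add hφ.1, add_neg_cancel, Real.rpow_zero, mul_one]
      · rw [indicator_of_notMem h, mul_zero, norm_zero]
        positivity
    · exact integrableOn_const (by simp)
    · refine Eventually.of_forall fun φ => ?_
      refine squeeze_zero_norm (a := fun θ => ‖q θ‖ * ‖b φ‖) (fun θ => ?_) ?_
      · rw [norm_mul]
        gcongr
        exact norm_indicator_le_norm_self _ _
      · simpa using hq0.norm.mul_const ‖b φ‖
  rw [integral_zero] at hD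
  refine hD.congr' ?_
  filter_upwards [hmem] with θ hθ
  rw [integral_const_mul, setIntegral_indicator measurableSet_Ioi]
  congr 3
  ext x
  simp only [mem_inter_iff, mem_Ioc, mem_Ioi]
  constructor
  · rintro ⟨⟨_, h⟩, h'⟩
    exact ⟨h', h⟩
  · rintro ⟨h, h'⟩
    exact ⟨⟨hθ.1.trans h, h'⟩, h⟩

/-- mapping properties of the Green's operator for `I_{s,ν}` built
from solutions `P = sin^{n-s} p` (Robin at `θ₀`) and `Q = sin^{n-s} q`
(`q = O(θ^{2s-n})` at `0`) with Wronskian `P'Q - PQ' = sin^{n-1}`. -/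
theorem stmt_13 (n : ℕ) (hn : 2 ≤ n) (s : ℝ) (hs : (n : ℝ) / 2 < s) (ν : ℝ)
    (θ₀ : ℝ) (hθ₀ : θ₀ ∈ Set.Ioo 0 Real.pi)
    (p q f P Q : ℝ → ℝ)
    (hPdef : ∀ θ, P θ = Real.sin θ ^ ((n : ℝ) - s) * p θ)
    (hQdef : ∀ θ, Q θ = Real.sin θ ^ ((n : ℝ) - s) * q θ)
    (hPC : ContDiffOn ℝ 2 P (Set.Ioc 0 θ₀)) (hQC : ContDiffOn ℝ 2 Q (Set.Ioc 0 θ₀))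
    (hIP : ∀ θ ∈ Set.Ioc 0 θ₀, IopW n s ν θ₀ P θ = 0)
    (hIQ : ∀ θ ∈ Set.Ioc 0 θ₀, IopW n s ν θ₀ Q θ = 0)
    (hWr : ∀ θ ∈ Set.Ioc 0 θ₀,
      dW θ₀ P θ * Q θ - P θ * dW θ₀ Q θ = Real.sin θ ^ (n - 1))
    (hpbdd : ∃ C : ℝ, ∀ θ ∈ Set.Ioc 0 θ₀, |p θ| ≤ C)
    (hp' : dW θ₀ p θ₀ = 0)
    (hqO : q =O[nhdsWithin 0 (Set.Ioi 0)] fun θ => θ ^ (2 * s - (n : ℝ)))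
    (hfc : ContinuousOn f (Set.Ioc 0 θ₀))
    (hfO : f =O[nhdsWithin 0 (Set.Ioi 0)] fun θ => θ ^ ((n : ℝ) - s + 1))
    (G : ℝ → ℝ)
    (hGdef : ∀ θ, G θ =
      Real.sin θ ^ ((n : ℝ) - s) * p θ
          * (∫ φ in Set.Ioc 0 θ, q φ * f φ / Real.sin φ ^ (s + 1))
        + Real.sin θ ^ ((n : ℝ) - s) * q θ
          * (∫ φ in Set.Ioc θ θ₀, p φ * f φ / Real.sin φ ^ (s + 1))) :
    (∀ θ ∈ Set.Ioc 0 θ₀,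
      IntegrableOn (fun φ => q φ * f φ / Real.sin φ ^ (s + 1)) (Set.Ioc 0 θ) ∧
      IntegrableOn (fun φ => p φ * f φ / Real.sin φ ^ (s + 1)) (Set.Ioc θ θ₀)) ∧
    ContDiffOn ℝ 2 G (Set.Ioc 0 θ₀) ∧
    (∀ θ ∈ Set.Ioc 0 θ₀, IopW n s ν θ₀ G θ = f θ) ∧
    Tendsto (fun θ => Real.sin θ ^ (s - (n : ℝ)) * G θ)
      (nhdsWithin 0 (Set.Ioi 0)) (nhds 0) ∧
    dW θ₀ G θ₀ + (s - (n : ℝ)) * Real.cot θ₀ * G θ₀ = 0 := by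
  have hπ : θ₀ < π := hθ₀.2
  have hsin : ∀ θ ∈ Ioc 0 θ₀, 0 < Real.sin θ := fun θ hθ =>
    Real.sin_pos_of_pos_of_lt_pi hθ.1 (hθ.2.trans_lt hπ)
  have hT : θ₀ ∈ Ioc 0 θ₀ := ⟨hθ₀.1, le_rfl⟩
  have hU := uniqueDiffOn_Ioc (0 : ℝ) θ₀
  have hsinpow : ∀ r : ℝ, ContinuousOn (fun θ => Real.sin θ ^ r) (Ioc 0 θ₀) := fun r =>
    Real.continuous_sin.continuousOn.rpow_const fun θ hθ => Or.inl (hsin θ hθ).ne'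
  have hcancel : ∀ θ ∈ Ioc 0 θ₀,
      Real.sin θ ^ (s - (n : ℝ)) * Real.sin θ ^ ((n : ℝ) - s) = 1 := fun θ hθ => by
    rw [← Real.rpow_add (hsin θ hθ), sub_add_sub_cancel', sub_self, Real.rpow_zero]
  have hpP : ∀ θ ∈ Ioc 0 θ₀, p θ = Real.sin θ ^ (s - (n : ℝ)) * P θ := fun θ hθ => by
    rw [hPdef, ← mul_assoc, hcancel θ hθ, one_mul]
  have hqQ : ∀ θ ∈ Ioc 0 θ₀, q θ = Real.sin θ ^ (s - (n : ℝ)) * Q θ := fun θ hθ => by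
    rw [hQdef, ← mul_assoc, hcancel θ hθ, one_mul]
  have hpc : ContinuousOn p (Ioc 0 θ₀) := ((hsinpow _).mul hPC.continuousOn).congr hpP
  have hqc : ContinuousOn q (Ioc 0 θ₀) := ((hsinpow _).mul hQC.continuousOn).congr hqQ
  obtain ⟨a, ha⟩ : ∃ a : ℝ → ℝ, a = fun φ => q φ * f φ / Real.sin φ ^ (s + 1) := ⟨_, rfl⟩
  obtain ⟨b, hb⟩ : ∃ b : ℝ → ℝ, b = fun φ => p φ * f φ / Real.sin φ ^ (s + 1) := ⟨_, rfl⟩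
  have hac : ContinuousOn a (Ioc 0 θ₀) := by
    rw [ha]
    exact (hqc.mul hfc).div (hsinpow _) fun θ hθ => (Real.rpow_pos_of_pos (hsin θ hθ) _).ne'
  have hbc : ContinuousOn b (Ioc 0 θ₀) := by
    rw [hb]
    exact (hpc.mul hfc).div (hsinpow _) fun θ hθ => (Real.rpow_pos_of_pos (hsin θ hθ) _).ne'
  have hpow : ∀ r : ℝ, ContinuousOn (fun θ : ℝ => θ ^ r) (Ioc 0 θ₀) := fun r =>
    continuousOn_id.rpow_const fun θ hθ => Or.inl hθ.1.ne'
  have hpowpos : ∀ r : ℝ, ∀ θ ∈ Ioc 0 θ₀, 0 < θ ^ r := fun r θ hθ =>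
    Real.rpow_pos_of_pos hθ.1 r
  have hr : 0 < 2 * s - (n : ℝ) := by linarith
  have hdO : (fun θ => (Real.sin θ ^ (s + 1))⁻¹) =O[nhdsWithin 0 (Ioi 0)]
      fun θ : ℝ => (θ ^ (s + 1))⁻¹ := (sin_rpow_isTheta_nhdsGT_zero (s + 1)).inv.1
  have haO : a =O[nhdsWithin 0 (Ioi 0)] fun _ => (1 : ℝ) := by
    rw [ha]
    refine ((hqO.mul hfO).mul hdO).congr' (Eventually.of_forall fun θ =>
      (div_eq_mul_inv _ _).symm) ?_
    filter_upwards [self_mem_nhdsWithin] with θ hθ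
    rw [← Real.rpow_neg (le_of_lt hθ), ← Real.rpow_add hθ, ← Real.rpow_add hθ]
    ring_nf
    exact Real.rpow_zero θ
  have hpO : p =O[nhdsWithin 0 (Ioi 0)] fun _ => (1 : ℝ) := by
    obtain ⟨C, hC⟩ := hpbdd
    refine IsBigO.of_bound C ?_
    filter_upwards [Ioc_mem_nhdsGT hθ₀.1] with θ hθ
    simpa using hC θ hθ
  have hbO : b =O[nhdsWithin 0 (Ioi 0)] fun θ : ℝ => θ ^ (-(2 * s - (n : ℝ))) := by
    rw [hb]
    refine ((hpO.mul hfO).mul hdO).congr' (Eventually.of_forall fun θ =>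
      (div_eq_mul_inv _ _).symm) ?_
    filter_upwards [self_mem_nhdsWithin] with θ hθ
    rw [one_mul, ← Real.rpow_neg (le_of_lt hθ), ← Real.rpow_add hθ]
    ring_nf
  obtain ⟨Ca, hCa, haB⟩ := exists_bound_Ioc_of_isBigO hac continuousOn_const
    (fun _ _ => one_pos) haO
  obtain ⟨Cb, hCb, hbB⟩ := exists_bound_Ioc_of_isBigO hbc (hpow _) (hpowpos _) hbO
  obtain ⟨Cq, hCq, hqB⟩ := exists_bound_Ioc_of_isBigO hqc (hpow _) (hpowpos _) hqO
  simp only [mul_one] at haB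
  have hai : ∀ θ ∈ Ioc 0 θ₀, IntegrableOn a (Ioc 0 θ) := fun θ hθ => by
    have hsub : Ioc 0 θ ⊆ Ioc 0 θ₀ := Ioc_subset_Ioc_right hθ.2
    refine IntegrableOn.of_bound (by simp)
      ((hac.mono hsub).aestronglyMeasurable measurableSet_Ioc) Ca ?_
    exact (ae_restrict_iff' measurableSet_Ioc).2
      (Eventually.of_forall fun φ hφ => haB φ (hsub hφ))
  have hbi : ∀ θ ∈ Ioc 0 θ₀, IntegrableOn b (Ioc θ θ₀) := fun θ hθ =>
    ((hbc.mono fun x hx => ⟨hθ.1.trans_le hx.1, hx.2⟩).integrableOn_Icc).mono_set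
      Ioc_subset_Icc_self
  obtain ⟨A, hA⟩ : ∃ A : ℝ → ℝ, A = fun θ => ∫ φ in Ioc 0 θ, a φ := ⟨_, rfl⟩
  obtain ⟨B, hB⟩ : ∃ B : ℝ → ℝ, B = fun θ => ∫ φ in Ioc θ θ₀, b φ := ⟨_, rfl⟩
  have hG : ∀ θ, G θ = P θ * A θ + Q θ * B θ := fun θ => by
    rw [hGdef, hPdef, hQdef, hA, hB, ha, hb]
  have hAd : ∀ θ ∈ Ioc 0 θ₀, HasDerivWithinAt A (a θ) (Ioc 0 θ₀) θ := fun θ hθ => by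
    refine (hasDerivWithinAt_integral_Ioc (c := 0) hac hθ
      ((intervalIntegrable_iff_integrableOn_Ioc_of_le hθ.1.le).2 (hai θ hθ))).congr_of_mem
        (fun x hx => ?_) hθ
    rw [hA, intervalIntegral.integral_of_le hx.1.le]
  have hBd : ∀ θ ∈ Ioc 0 θ₀, HasDerivWithinAt B (-b θ) (Ioc 0 θ₀) θ := fun θ hθ => by
    refine (hasDerivWithinAt_integral_Ioc (c := θ₀) hbc hθ
      ((intervalIntegrable_iff_integrableOn_Ioc_of_le hθ.2).2 (hbi θ hθ)).symm).neg.congr_of_mem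
        (fun x hx => ?_) hθ
    rw [hB, Pi.neg_apply, intervalIntegral.integral_symm, neg_neg,
      intervalIntegral.integral_of_le hx.2]
  have h2 : (2 : WithTop ℕ∞) = 1 + 1 := by norm_num
  rw [h2, contDiffOn_succ_iff_derivWithin hU] at hPC hQC
  obtain ⟨hPd, -, hP1⟩ := hPC
  obtain ⟨hQd, -, hQ1⟩ := hQC
  have hA1 : ContDiffOn ℝ 1 A (Ioc 0 θ₀) :=
    (contDiffOn_one_iff_derivWithin hU).2 ⟨fun θ hθ => (hAd θ hθ).differentiableWithinAt,
      hac.congr fun θ hθ => (hAd θ hθ).derivWithin (hU θ hθ)⟩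
  have hB1 : ContDiffOn ℝ 1 B (Ioc 0 θ₀) :=
    (contDiffOn_one_iff_derivWithin hU).2 ⟨fun θ hθ => (hBd θ hθ).differentiableWithinAt,
      hbc.neg.congr fun θ hθ => (hBd θ hθ).derivWithin (hU θ hθ)⟩
  have hPQ : ∀ θ, P θ * a θ = Q θ * b θ := fun θ => by
    rw [ha, hb, hPdef, hQdef]
    ring
  have hGd : ∀ θ ∈ Ioc 0 θ₀, HasDerivWithinAt G (dW θ₀ P θ * A θ + dW θ₀ Q θ * B θ)
      (Ioc 0 θ₀) θ := fun θ hθ => by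
    have h := ((hPd θ hθ).hasDerivWithinAt.mul (hAd θ hθ)).add
      ((hQd θ hθ).hasDerivWithinAt.mul (hBd θ hθ))
    refine (h.congr_of_mem (fun x _ => hG x) hθ).congr_deriv ?_
    simp only [dW]
    linear_combination hPQ θ
  have hGdW : ∀ θ ∈ Ioc 0 θ₀, dW θ₀ G θ = dW θ₀ P θ * A θ + dW θ₀ Q θ * B θ :=
    fun θ hθ => (hGd θ hθ).derivWithin (hU θ hθ)
  have hGdd : ∀ θ ∈ Ioc 0 θ₀, dW θ₀ (dW θ₀ G) θ =
      dW θ₀ (dW θ₀ P) θ * A θ + dW θ₀ P θ * a θ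
        + (dW θ₀ (dW θ₀ Q) θ * B θ + dW θ₀ Q θ * (-b θ)) := fun θ hθ => by
    have h := (((hP1.differentiableOn one_ne_zero) θ hθ).hasDerivWithinAt.mul (hAd θ hθ)).add
      (((hQ1.differentiableOn one_ne_zero) θ hθ).hasDerivWithinAt.mul (hBd θ hθ))
    exact (h.congr_of_mem (fun x hx => hGdW x hx) hθ).derivWithin (hU θ hθ)
  have hAlim : Tendsto A (nhdsWithin 0 (Ioi 0)) (nhds 0) := by
    refine squeeze_zero_norm' (a := fun θ => Ca * θ) ?_ ?_
    · filter_upwards [Ioc_mem_nhdsGT hθ₀.1] with θ hθ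
      rw [hA]
      have h := norm_setIntegral_le_of_norm_le_const (μ := volume) (s := Ioc 0 θ) (f := a)
        (C := Ca) (by simp) fun φ hφ => haB φ ⟨hφ.1, hφ.2.trans hθ.2⟩
      simpa [hθ.1.le] using h
    · have h : Tendsto (fun θ : ℝ => Ca * θ) (nhds 0) (nhds (Ca * 0)) :=
        tendsto_id.const_mul Ca
      rw [mul_zero] at h
      exact h.mono_left nhdsWithin_le_nhds
  refine ⟨fun θ hθ => ⟨ha ▸ hai θ hθ, hb ▸ hbi θ hθ⟩, ?_, fun θ hθ => ?_, ?_, ?_⟩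
  · rw [h2, contDiffOn_succ_iff_derivWithin hU]
    refine ⟨fun θ hθ => (hGd θ hθ).differentiableWithinAt, by simp, ?_⟩
    exact ((hP1.mul hA1).add (hQ1.mul hB1)).congr hGdW
  · have hW := hWr θ hθ
    have h1 := hIP θ hθ
    have h3 := hIQ θ hθ
    have hs0 := hsin θ hθ
    have hsrc : Real.sin θ ^ 2 * (dW θ₀ P θ * a θ - dW θ₀ Q θ * b θ) = f θ := by
      have hpow : Real.sin θ ^ 2 * Real.sin θ ^ (n - 1) * Real.sin θ ^ (s - (n : ℝ))
          = Real.sin θ ^ (s + 1) := by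
        rw [← pow_add, ← Real.rpow_natCast, ← Real.rpow_add hs0]
        congr 1
        have : 2 + (n - 1) = n + 1 := by omega
        rw [this]
        push_cast
        ring
      have hne : Real.sin θ ^ (s + 1) ≠ 0 := (Real.rpow_pos_of_pos hs0 _).ne'
      calc Real.sin θ ^ 2 * (dW θ₀ P θ * a θ - dW θ₀ Q θ * b θ)
          = Real.sin θ ^ 2 * (dW θ₀ P θ * Q θ - P θ * dW θ₀ Q θ)
              * Real.sin θ ^ (s - (n : ℝ)) * (f θ / Real.sin θ ^ (s + 1)) := by
            simp only [ha, hb]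
            rw [hpP θ hθ, hqQ θ hθ]
            ring
        _ = f θ := by
            rw [hW, hpow]
            field_simp
    unfold IopW at h1 h3 ⊢
    rw [hGdd θ hθ, hGdW θ hθ, hG θ]
    linear_combination A θ * h1 + B θ * h3 + hsrc
  · have hqBlim : Tendsto (fun θ => q θ * B θ) (nhdsWithin 0 (Ioi 0)) (nhds 0) := by
      rw [hB]
      exact tendsto_mul_setIntegral_Ioc_zero hθ₀.1 hr hCq hCb hbc hqB hbB
    have hpA : Tendsto (fun θ => p θ * A θ) (nhdsWithin 0 (Ioi 0)) (nhds 0) := by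
      have h := hpO.mul_isLittleO ((isLittleO_one_iff ℝ).2 hAlim)
      simp only [mul_one] at h
      exact (isLittleO_one_iff ℝ).1 h
    have h := hpA.add hqBlim
    rw [add_zero] at h
    refine h.congr' ?_
    filter_upwards [Ioc_mem_nhdsGT hθ₀.1] with θ hθ
    rw [hG, hpP θ hθ, hqQ θ hθ]
    ring
  · have hBT : B θ₀ = 0 := by simp [hB]
    have hs0 := hsin θ₀ hT
    have hsd : ∀ r : ℝ, HasDerivWithinAt (fun θ => Real.sin θ ^ r)
        (Real.cos θ₀ * r * Real.sin θ₀ ^ (r - 1)) (Ioc 0 θ₀) θ₀ := fun r =>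
      ((Real.hasDerivAt_sin θ₀).rpow_const (Or.inl hs0.ne')).hasDerivWithinAt
    have hpd : HasDerivWithinAt p 0 (Ioc 0 θ₀) θ₀ := by
      have h : DifferentiableWithinAt ℝ p (Ioc 0 θ₀) θ₀ :=
        ((hsd _).differentiableWithinAt.mul (hPd θ₀ hT)).congr hpP (hpP θ₀ hT)
      have := h.hasDerivWithinAt
      rwa [show derivWithin p (Ioc 0 θ₀) θ₀ = 0 from hp'] at this
    have hP' : dW θ₀ P θ₀ =
        Real.cos θ₀ * ((n : ℝ) - s) * Real.sin θ₀ ^ ((n : ℝ) - s - 1) * p θ₀ := by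
      have h := (((hsd ((n : ℝ) - s)).mul hpd).congr_of_mem (fun x _ => hPdef x) hT).derivWithin
        (hU θ₀ hT)
      rw [mul_zero, add_zero] at h
      exact h
    rw [hGdW θ₀ hT, hG, hBT, hP', hPdef, Real.cot_eq_cos_div_sin, Real.rpow_sub_one hs0.ne']
    field_simp
    ring
end

section
/- Let n ≥ 2 be an integer, s > n/2 a real number, ν ∈ ℝ, and θ₀ ∈ (0, π). Suppose β ∈ C²((0, θ₀]) satisfies I_{s,ν} β = 0 on (0, θ₀], with β(θ) = O(θ^s) and β'(θ) = O(θ^{s−1}) as θ → 0⁺, and β'(θ₀) + (s − n)·cot(θ₀)·β(θ₀) = 0. Suppose u ∈ C²((0, θ₀]) satisfies u(θ) = O(θ^{n−s+1}), u'(θ) = O(θ^{n−s}), and u''(θ) = O(θ^{n−s−1}) as θ → 0⁺, and u'(θ₀) + (s − n)·cot(θ₀)·u(θ₀) = 0. Then the integral ∫₀^{θ₀} (I_{s,ν} u)(θ)·β(θ)·sin(θ)^{−(n+1)} dθ converges absolutely and equals 0. -/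
open Real MeasureTheory Set Filter Asymptotics

section PowerAsymptotics

theorem isBigO_mul_rpow {f g : ℝ → ℝ} {a b c : ℝ}
    (hf : f =O[nhdsWithin 0 (Set.Ioi 0)] fun θ => θ ^ a)
    (hg : g =O[nhdsWithin 0 (Set.Ioi 0)] fun θ => θ ^ b) (h : a + b = c) :
    (fun θ => f θ * g θ) =O[nhdsWithin 0 (Set.Ioi 0)] fun θ => θ ^ c := by
  refine (hf.mul hg).congr' EventuallyEq.rfl ?_
  filter_upwards [self_mem_nhdsWithin] with θ hθ
  rw [← Real.rpow_add hθ, h]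

theorem sin_isBigO_rpow_one :
    Real.sin =O[nhdsWithin 0 (Set.Ioi 0)] fun θ : ℝ => θ ^ (1 : ℝ) := by
  refine IsBigO.of_bound 1 (Eventually.of_forall fun θ => ?_)
  simpa using Real.abs_sin_le_abs

theorem const_isBigO_rpow_zero (c : ℝ) :
    (fun _ : ℝ => c) =O[nhdsWithin 0 (Set.Ioi 0)] fun θ : ℝ => θ ^ (0 : ℝ) := by
  simpa using isBigO_const_const c (one_ne_zero (α := ℝ)) (nhdsWithin (0 : ℝ) (Set.Ioi 0))

theorem cos_isBigO_rpow_zero :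
    Real.cos =O[nhdsWithin 0 (Set.Ioi 0)] fun θ : ℝ => θ ^ (0 : ℝ) := by
  refine IsBigO.of_bound 1 (Eventually.of_forall fun θ => ?_)
  simpa using Real.abs_cos_le_one θ

theorem inv_sin_pow_isBigO_rpow_neg (k : ℕ) :
    (fun θ => (Real.sin θ ^ k)⁻¹) =O[nhdsWithin 0 (Set.Ioi 0)]
      fun θ : ℝ => θ ^ (-(k : ℝ)) := by
  have h : (fun θ : ℝ => θ) =O[nhdsWithin 0 (Set.Ioi 0)] Real.sin := by
    refine IsBigO.of_bound (Real.pi / 2) ?_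
    filter_upwards [Ioo_mem_nhdsGT (half_pos Real.pi_pos)] with θ hθ
    have h1 := Real.mul_le_sin hθ.1.le hθ.2.le
    have h2 : θ = Real.pi / 2 * (2 / Real.pi * θ) := by field_simp
    rw [Real.norm_of_nonneg hθ.1.le, Real.norm_eq_abs]
    calc θ = Real.pi / 2 * (2 / Real.pi * θ) := h2
      _ ≤ Real.pi / 2 * |Real.sin θ| := by gcongr; exact h1.trans (le_abs_self _)
  have hinv := (h.pow k).inv_rev (by
    filter_upwards [self_mem_nhdsWithin] with θ hθ h0
    exact absurd h0 (pow_ne_zero k (ne_of_gt hθ)))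
  refine hinv.congr' EventuallyEq.rfl ?_
  filter_upwards [self_mem_nhdsWithin] with θ hθ
  rw [Real.rpow_neg (le_of_lt hθ), Real.rpow_natCast]

end PowerAsymptotics

theorem hasDerivAt_of_differentiableOn_Ioc {f : ℝ → ℝ} {b x : ℝ}
    (hf : DifferentiableOn ℝ f (Set.Ioc 0 b)) (hx : x ∈ Set.Ioo 0 b) :
    HasDerivAt f (dW b f x) x :=
  (hf x (Ioo_subset_Ioc_self hx)).hasDerivWithinAt.hasDerivAt (Ioc_mem_nhds hx.1 hx.2)

theorem contDiffOn_one_dW {f : ℝ → ℝ} {b : ℝ} (hf : ContDiffOn ℝ 2 f (Set.Ioc 0 b)) :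
    ContDiffOn ℝ 1 (dW b f) (Set.Ioc 0 b) :=
  hf.derivWithin (uniqueDiffOn_Ioc 0 b) (by norm_num)

theorem integrableOn_Ioc_of_continuousOn_of_isBigO_one {f : ℝ → ℝ} {b : ℝ} (hb : 0 < b)
    (hf : ContinuousOn f (Set.Ioc 0 b))
    (h0 : f =O[nhdsWithin 0 (Set.Ioi 0)] fun _ => (1 : ℝ)) :
    IntegrableOn f (Set.Ioc 0 b) := by
  obtain ⟨C, hC⟩ := h0.bound
  obtain ⟨ε, hε, hεC⟩ := (mem_nhdsGT_iff_exists_Ioc_subset).1 hC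
  have hsub : Set.Ioc 0 b ⊆ Set.Ioc 0 (min ε b) ∪ Set.Icc (min ε b) b := fun x hx =>
    (le_total x (min ε b)).imp (fun h => ⟨hx.1, h⟩) fun h => ⟨h, hx.2⟩
  refine IntegrableOn.mono_set (IntegrableOn.union ?_ ?_) hsub
  · refine IntegrableOn.of_bound (C := C) (by simp)
      ((hf.mono (Ioc_subset_Ioc_right (min_le_right _ _))).aestronglyMeasurable
        measurableSet_Ioc) ?_
    filter_upwards [ae_restrict_mem measurableSet_Ioc] with x hx
    simpa using hεC ⟨hx.1, hx.2.trans (min_le_left _ _)⟩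
  · exact (hf.mono fun x hx => ⟨(lt_min hε hb).trans_le hx.1, hx.2⟩).integrableOn_compact
      isCompact_Icc

/-- The Wronskian of `u` and `β` on `(0, θ₀]`, weighted so that its derivative is the
skew-symmetrization of the indicial operator against `sin(θ)^{-(n+1)}`. -/
noncomputable def weightedWronskian (n : ℕ) (θ₀ : ℝ) (u β : ℝ → ℝ) (θ : ℝ) : ℝ :=
  (dW θ₀ u θ * β θ - u θ * dW θ₀ β θ) * (Real.sin θ * (Real.sin θ ^ n)⁻¹)

theorem hasDerivAt_weightedWronskian (n : ℕ) (s ν : ℝ) {θ₀ : ℝ} {u β : ℝ → ℝ} {θ : ℝ}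
    (hu : ContDiffOn ℝ 2 u (Set.Ioc 0 θ₀)) (hβ : ContDiffOn ℝ 2 β (Set.Ioc 0 θ₀))
    (hθ : θ ∈ Set.Ioo 0 θ₀) (hsin : Real.sin θ ≠ 0) :
    HasDerivAt (weightedWronskian n θ₀ u β)
      ((IopW n s ν θ₀ u θ * β θ - u θ * IopW n s ν θ₀ β θ) / Real.sin θ ^ (n + 1)) θ := by
  have hu1 := hasDerivAt_of_differentiableOn_Ioc (hu.differentiableOn (by norm_num)) hθ
  have hβ1 := hasDerivAt_of_differentiableOn_Ioc (hβ.differentiableOn (by norm_num)) hθ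
  have hu2 := hasDerivAt_of_differentiableOn_Ioc
    ((contDiffOn_one_dW hu).differentiableOn (by norm_num)) hθ
  have hβ2 := hasDerivAt_of_differentiableOn_Ioc
    ((contDiffOn_one_dW hβ).differentiableOn (by norm_num)) hθ
  have hs := Real.hasDerivAt_sin θ
  have hW := ((hu2.mul hβ1).sub (hu1.mul hβ2)).mul
    (hs.mul ((hs.pow n).inv (pow_ne_zero n hsin)))
  refine hW.congr_deriv ?_
  simp only [IopW, Pi.mul_apply, Pi.sub_apply, Pi.pow_apply, Pi.inv_apply]
  rcases n with _ | n
  · field_simp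
    simp
    ring
  · simp only [Nat.add_sub_cancel]
    push_cast
    field_simp
    ring

theorem continuousOn_IopW (n : ℕ) (s ν : ℝ) {θ₀ : ℝ} {u : ℝ → ℝ}
    (hu : ContDiffOn ℝ 2 u (Set.Ioc 0 θ₀)) :
    ContinuousOn (IopW n s ν θ₀ u) (Set.Ioc 0 θ₀) := by
  have h0 := hu.continuousOn
  have h1 := (contDiffOn_one_dW hu).continuousOn
  have h2 : ContinuousOn (dW θ₀ (dW θ₀ u)) (Set.Ioc 0 θ₀) :=
    (contDiffOn_one_dW hu).continuousOn_derivWithin (uniqueDiffOn_Ioc 0 θ₀) le_rfl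
  have hs := Real.continuous_sin.continuousOn (s := Set.Ioc 0 θ₀)
  have hc := Real.continuous_cos.continuousOn (s := Set.Ioc 0 θ₀)
  unfold IopW
  fun_prop

theorem isBigO_IopW (n : ℕ) (s ν : ℝ) {θ₀ a : ℝ} {u : ℝ → ℝ}
    (hu : u =O[nhdsWithin 0 (Set.Ioi 0)] fun θ => θ ^ (a + 1))
    (hu' : dW θ₀ u =O[nhdsWithin 0 (Set.Ioi 0)] fun θ => θ ^ a)
    (hu'' : dW θ₀ (dW θ₀ u) =O[nhdsWithin 0 (Set.Ioi 0)] fun θ => θ ^ (a - 1)) :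
    IopW n s ν θ₀ u =O[nhdsWithin 0 (Set.Ioi 0)] fun θ => θ ^ (a + 1) := by
  have hs := sin_isBigO_rpow_one
  have hs2 : (fun θ => Real.sin θ ^ 2) =O[nhdsWithin 0 (Set.Ioi 0)] fun θ : ℝ => θ ^ (2 : ℝ) := by
    simpa only [sq] using isBigO_mul_rpow hs hs (by norm_num : (1 : ℝ) + 1 = 2)
  have hs0 : (fun θ => Real.sin θ ^ 2) =O[nhdsWithin 0 (Set.Ioi 0)] fun θ : ℝ => θ ^ (0 : ℝ) := by
    refine IsBigO.of_bound 1 (Eventually.of_forall fun θ => ?_)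
    simpa using Real.sin_sq_le_one θ
  have t1 := isBigO_mul_rpow hs2 hu'' (by ring : 2 + (a - 1) = a + 1)
  have t2 := isBigO_mul_rpow (isBigO_mul_rpow (isBigO_mul_rpow
    (const_isBigO_rpow_zero (1 - (n : ℝ))) hs rfl) cos_isBigO_rpow_zero rfl) hu'
    (by ring : 0 + 1 + 0 + a = a + 1)
  have t3 := isBigO_mul_rpow (isBigO_mul_rpow
    (const_isBigO_rpow_zero (ν * (ν + 1 - (n : ℝ)))) hs0 rfl) hu
    (by ring : 0 + 0 + (a + 1) = a + 1)
  have t4 := isBigO_mul_rpow (const_isBigO_rpow_zero (s * ((n : ℝ) - s))) hu (zero_add (a + 1))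
  exact ((t1.add t2).add t3).add t4

/-- orthogonality of the image of `I_{s,ν}` (with Dirichlet-type
decay at 0 and Robin condition at `θ₀`) to kernel elements `β`, with respect to
the measure `sin(θ)^{-(n+1)} dθ`. -/
theorem stmt_15 (n : ℕ) (hn : 2 ≤ n) (s : ℝ) (hs : (n : ℝ) / 2 < s) (ν : ℝ)
    (θ₀ : ℝ) (hθ₀ : θ₀ ∈ Set.Ioo 0 Real.pi)
    (β u : ℝ → ℝ)
    (hβC : ContDiffOn ℝ 2 β (Set.Ioc 0 θ₀))
    (hIβ : ∀ θ ∈ Set.Ioc 0 θ₀, IopW n s ν θ₀ β θ = 0)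
    (hβO : β =O[nhdsWithin 0 (Set.Ioi 0)] fun θ => θ ^ s)
    (hβ'O : dW θ₀ β =O[nhdsWithin 0 (Set.Ioi 0)] fun θ => θ ^ (s - 1))
    (hβR : dW θ₀ β θ₀ + (s - (n : ℝ)) * Real.cot θ₀ * β θ₀ = 0)
    (huC : ContDiffOn ℝ 2 u (Set.Ioc 0 θ₀))
    (huO : u =O[nhdsWithin 0 (Set.Ioi 0)] fun θ => θ ^ ((n : ℝ) - s + 1))
    (hu'O : dW θ₀ u =O[nhdsWithin 0 (Set.Ioi 0)] fun θ => θ ^ ((n : ℝ) - s))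
    (hu''O : dW θ₀ (dW θ₀ u) =O[nhdsWithin 0 (Set.Ioi 0)]
      fun θ => θ ^ ((n : ℝ) - s - 1))
    (huR : dW θ₀ u θ₀ + (s - (n : ℝ)) * Real.cot θ₀ * u θ₀ = 0) :
    IntegrableOn (fun θ => IopW n s ν θ₀ u θ * β θ / Real.sin θ ^ (n + 1))
      (Set.Ioc 0 θ₀) ∧
    (∫ θ in Set.Ioc 0 θ₀, IopW n s ν θ₀ u θ * β θ / Real.sin θ ^ (n + 1)) = 0 := by
  have hsin : ∀ θ ∈ Set.Ioc 0 θ₀, Real.sin θ ≠ 0 := fun θ hθ =>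
    (Real.sin_pos_of_pos_of_lt_pi hθ.1 (hθ.2.trans_lt hθ₀.2)).ne'
  have hmem : θ₀ ∈ Set.Ioc 0 θ₀ := ⟨hθ₀.1, le_rfl⟩
  have hint : IntegrableOn (fun θ => IopW n s ν θ₀ u θ * β θ / Real.sin θ ^ (n + 1))
      (Set.Ioc 0 θ₀) := by
    refine integrableOn_Ioc_of_continuousOn_of_isBigO_one hθ₀.1 ?_ ?_
    · exact ((continuousOn_IopW n s ν huC).mul hβC.continuousOn).div
        (Real.continuous_sin.continuousOn.pow _) fun θ hθ => pow_ne_zero _ (hsin θ hθ)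
    · have h := isBigO_mul_rpow (isBigO_mul_rpow (isBigO_IopW n s ν huO hu'O hu''O) hβO rfl)
        (inv_sin_pow_isBigO_rpow_neg (n + 1))
        (by push_cast; ring : (n : ℝ) - s + 1 + s + -((n + 1 : ℕ) : ℝ) = 0)
      simpa [div_eq_mul_inv] using h
  refine ⟨hint, ?_⟩
  have hderiv : ∀ θ ∈ Set.Ioo 0 θ₀, HasDerivAt (weightedWronskian n θ₀ u β)
      (IopW n s ν θ₀ u θ * β θ / Real.sin θ ^ (n + 1)) θ := fun θ hθ => by
    have hθ' := Ioo_subset_Ioc_self hθ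
    simpa [hIβ θ hθ'] using hasDerivAt_weightedWronskian n s ν huC hβC hθ (hsin θ hθ')
  have hzero : Tendsto (weightedWronskian n θ₀ u β) (nhdsWithin 0 (Set.Ioi 0)) (nhds 0) := by
    have hw := isBigO_mul_rpow sin_isBigO_rpow_one (inv_sin_pow_isBigO_rpow_neg n) rfl
    have h1 := isBigO_mul_rpow hu'O hβO (sub_add_cancel (n : ℝ) s)
    have h2 := isBigO_mul_rpow huO hβ'O (by ring : (n : ℝ) - s + 1 + (s - 1) = n)
    have h : weightedWronskian n θ₀ u β =O[nhdsWithin 0 (Set.Ioi 0)] fun θ => θ ^ (1 : ℝ) :=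
      isBigO_mul_rpow (h1.sub h2) hw (by ring)
    refine h.trans_tendsto ?_
    simp only [Real.rpow_one]
    exact tendsto_id.mono_left nhdsWithin_le_nhds
  have hend : weightedWronskian n θ₀ u β θ₀ = 0 := by
    have h : dW θ₀ u θ₀ * β θ₀ - u θ₀ * dW θ₀ β θ₀ = 0 := by
      linear_combination β θ₀ * huR - u θ₀ * hβR
    rw [weightedWronskian, h, zero_mul]
  have hleft : Tendsto (weightedWronskian n θ₀ u β) (nhdsWithin θ₀ (Set.Iio θ₀)) (nhds 0) := by
    have hs := Real.continuous_sin.continuousOn (s := Set.Ioc 0 θ₀)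
    have hcont : ContinuousOn (weightedWronskian n θ₀ u β) (Set.Ioc 0 θ₀) :=
      (((contDiffOn_one_dW huC).continuousOn.mul hβC.continuousOn).sub
        (huC.continuousOn.mul (contDiffOn_one_dW hβC).continuousOn)).mul
        (hs.mul ((hs.pow n).inv₀ fun θ hθ => pow_ne_zero n (hsin θ hθ)))
    rw [← hend, ← nhdsWithin_Ioo_eq_nhdsLT hθ₀.1]
    exact (hcont θ₀ hmem).mono_left (nhdsWithin_mono _ Ioo_subset_Ioc_self)
  rw [← intervalIntegral.integral_of_le hθ₀.1.le,
    intervalIntegral.integral_eq_sub_of_hasDerivAt_of_tendsto hθ₀.1 hderiv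
      ((intervalIntegrable_iff_integrableOn_Ioc_of_le hθ₀.1.le).2 hint) hzero hleft, sub_zero]
end

section
/- Let n ≥ 2 be an integer, θ₀ ∈ (0, π), c ∈ ℝ, and let f be continuous on (0, θ₀] with f(θ) = O(θ⁴) as θ → 0⁺. Then there exists exactly one function ℓ, continuous on [0, θ₀] and C² on (0, θ₀], such that sin²(θ)·ℓ''(θ) − sin(θ)·cos(θ)·ℓ'(θ) = 2·f(θ) for all θ ∈ (0, θ₀], ℓ(0) = c, and ℓ'(θ₀) = 0. Moreover this solution satisfies ℓ'(θ) = −2·sin(θ)·∫_θ^{θ₀} csc³(φ)·f(φ) dφ for all θ ∈ (0, θ₀], where the improper integral converges. -/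
open Real MeasureTheory Set Filter Asymptotics

/-- The boundary value problem of STATEMENT 19: `ℓ` is continuous on `[0, θ₀]`,
`C²` on `(0, θ₀]`, solves `sin²θ · ℓ'' − sinθ cosθ · ℓ' = 2 f` on `(0, θ₀]`,
with `ℓ(0) = c` and `ℓ'(θ₀) = 0` (derivatives taken within `(0, θ₀]`). -/
def Solves (θ₀ c : ℝ) (f ℓ : ℝ → ℝ) : Prop :=
  ContinuousOn ℓ (Set.Icc 0 θ₀) ∧
  ContDiffOn ℝ 2 ℓ (Set.Ioc 0 θ₀) ∧
  (∀ θ ∈ Set.Ioc 0 θ₀,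
    Real.sin θ ^ 2 * derivWithin (derivWithin ℓ (Set.Ioc 0 θ₀)) (Set.Ioc 0 θ₀) θ
      - Real.sin θ * Real.cos θ * derivWithin ℓ (Set.Ioc 0 θ₀) θ = 2 * f θ) ∧
  ℓ 0 = c ∧
  derivWithin ℓ (Set.Ioc 0 θ₀) θ₀ = 0

/-- Since `csc³ f = O(θ)` and division by zero gives `0`, the quotient `f / sin³` is continuous
up to and including the endpoint `0`. -/
theorem continuousOn_div_sin_cube {θ₀ : ℝ} (hθ₀ : θ₀ ∈ Set.Ioo 0 Real.pi) {f : ℝ → ℝ}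
    (hfc : ContinuousOn f (Set.Ioc 0 θ₀))
    (hfO : f =O[nhdsWithin 0 (Set.Ioi 0)] fun θ => θ ^ 4) :
    ContinuousOn (fun φ => f φ / Real.sin φ ^ 3) (Set.Icc 0 θ₀) := by
  have hsin : ∀ x ∈ Set.Ioc 0 θ₀, 0 < Real.sin x := fun x hx =>
    Real.sin_pos_of_pos_of_lt_pi hx.1 (hx.2.trans_lt hθ₀.2)
  have hc : ContinuousOn (fun φ => f φ / Real.sin φ ^ 3) (Set.Ioc 0 θ₀) :=
    hfc.div (by fun_prop) fun x hx => pow_ne_zero _ (hsin x hx).ne'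
  intro x hx
  rcases hx.1.eq_or_lt with rfl | hx0
  · rw [← Set.Ioc_insert_left hθ₀.1.le, continuousWithinAt_insert_self]
    refine ContinuousWithinAt.mono (t := Set.Ioi 0) ?_ Set.Ioc_subset_Ioi_self
    have hid : (fun θ : ℝ => θ) =O[nhdsWithin 0 (Set.Ioi 0)] Real.sin := by
      refine IsBigO.of_bound (Real.pi / 2) ?_
      filter_upwards [Ioo_mem_nhdsGT (show (0 : ℝ) < Real.pi / 2 by positivity)] with θ hθ
      have h := Real.mul_le_sin hθ.1.le hθ.2.le
      have h2 : θ ≤ Real.pi / 2 * Real.sin θ := by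
        have := mul_le_mul_of_nonneg_left h (show (0 : ℝ) ≤ Real.pi / 2 by positivity)
        have e : Real.pi / 2 * (2 / Real.pi * θ) = θ := by field_simp
        linarith
      rw [Real.norm_of_nonneg hθ.1.le]
      exact h2.trans (mul_le_mul_of_nonneg_left (le_abs_self _) (by positivity))
    have hO : (fun φ => f φ / Real.sin φ ^ 3) =O[nhdsWithin 0 (Set.Ioi 0)] fun θ : ℝ => θ := by
      have h1 : (fun θ : ℝ => θ ^ 4) =O[nhdsWithin 0 (Set.Ioi 0)]
          fun θ => Real.sin θ ^ 3 * θ :=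
        ((hid.pow 3).mul (isBigO_refl (fun θ : ℝ => θ) _)).congr_left fun θ => by ring
      have h2 := (hfO.trans h1).mul (isBigO_refl (fun θ => (Real.sin θ ^ 3)⁻¹) _)
      refine (h2.congr_left fun θ => (div_eq_mul_inv _ _).symm).congr' EventuallyEq.rfl ?_
      filter_upwards [Ioo_mem_nhdsGT Real.pi_pos] with θ hθ
      have := (Real.sin_pos_of_pos_of_lt_pi hθ.1 hθ.2).ne'
      field_simp
    have h0 : Tendsto (fun θ : ℝ => θ) (nhdsWithin 0 (Set.Ioi 0)) (nhds 0) :=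
      tendsto_nhdsWithin_of_tendsto_nhds tendsto_id
    simpa [ContinuousWithinAt] using hO.trans_tendsto h0
  · refine (hc x ⟨hx0, hx.2⟩).mono_of_mem_nhdsWithin ?_
    filter_upwards [self_mem_nhdsWithin, mem_nhdsWithin_of_mem_nhds (Ioi_mem_nhds hx0)]
      with y hy hy0 using ⟨hy0, hy.2⟩

theorem exists_solves {θ₀ : ℝ} (hθ₀ : θ₀ ∈ Set.Ioo 0 Real.pi) (c : ℝ) {f : ℝ → ℝ}
    (hg : ContinuousOn (fun φ => f φ / Real.sin φ ^ 3) (Set.Icc 0 θ₀)) :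
    ∃ ℓ : ℝ → ℝ, Solves θ₀ c f ℓ ∧
      ∀ θ ∈ Set.Ioc 0 θ₀,
        derivWithin ℓ (Set.Ioc 0 θ₀) θ
          = -2 * Real.sin θ * ∫ φ in Set.Ioc θ θ₀, f φ / Real.sin φ ^ 3 := by
  obtain ⟨G, hG, hGg⟩ : ∃ G : ℝ → ℝ, Continuous G ∧
      ∀ x ∈ Set.Icc 0 θ₀, G x = f x / Real.sin x ^ 3 :=
    ⟨_, hg.domRestrict.Icc_extend' (h := hθ₀.1.le), fun x hx => Set.IccExtend_of_mem _ _ hx⟩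
  set H : ℝ → ℝ := fun θ => ∫ φ in θ..θ₀, G φ with hH
  have hH' : ∀ x, HasDerivAt H (-G x) x := fun x =>
    intervalIntegral.integral_hasDerivAt_left (hG.intervalIntegrable _ _)
      hG.stronglyMeasurable.stronglyMeasurableAtFilter hG.continuousAt
  have hHc : Continuous H := continuous_iff_continuousAt.2 fun x => (hH' x).continuousAt
  set p : ℝ → ℝ := fun θ => -2 * Real.sin θ * H θ with hp
  have hp' : ∀ x, HasDerivAt p (-2 * Real.cos x * H x + -2 * Real.sin x * -G x) x := fun x =>
    ((Real.hasDerivAt_sin x).const_mul (-2)).mul (hH' x)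
  have hpc : Continuous p := by fun_prop
  set ℓ : ℝ → ℝ := fun θ => c + ∫ φ in (0 : ℝ)..θ, p φ with hℓ
  have hℓ' : ∀ x, HasDerivAt ℓ (p x) x := fun x =>
    (intervalIntegral.integral_hasDerivAt_right (hpc.intervalIntegrable _ _)
      hpc.stronglyMeasurable.stronglyMeasurableAtFilter hpc.continuousAt).const_add c
  have hpC : ContDiff ℝ 1 p := by
    refine contDiff_one_iff_deriv.2 ⟨fun x => (hp' x).differentiableAt, ?_⟩
    rw [funext fun x => (hp' x).deriv]
    fun_prop
  have hℓC : ContDiff ℝ 2 ℓ := by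
    refine (contDiff_succ_iff_deriv (n := 1)).2
      ⟨fun x => (hℓ' x).differentiableAt, by simp, ?_⟩
    rwa [funext fun x => (hℓ' x).deriv]
  have hU := uniqueDiffOn_Ioc (0 : ℝ) θ₀
  have hd : ∀ x ∈ Set.Ioc 0 θ₀, derivWithin ℓ (Set.Ioc 0 θ₀) x = p x := fun x hx =>
    (hℓ' x).hasDerivWithinAt.derivWithin (hU x hx)
  refine ⟨ℓ, ⟨hℓC.continuous.continuousOn, hℓC.contDiffOn, fun x hx => ?_, by simp [hℓ], ?_⟩,
    fun x hx => ?_⟩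
  · rw [derivWithin_congr hd (hd x hx), hd x hx,
      (hp' x).hasDerivWithinAt.derivWithin (hU x hx), hGg x ⟨hx.1.le, hx.2⟩]
    have := (Real.sin_pos_of_pos_of_lt_pi hx.1 (hx.2.trans_lt hθ₀.2)).ne'
    simp only [hp]
    field_simp
    ring
  · rw [hd θ₀ ⟨hθ₀.1, le_rfl⟩]
    simp [hp, hH]
  · rw [hd x hx]
    simp only [hp, hH]
    rw [intervalIntegral.integral_of_le hx.2]
    congr 1
    exact setIntegral_congr_fun measurableSet_Ioc fun y hy =>
      hGg y ⟨(hx.1.trans hy.1).le, hy.2⟩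

theorem eqOn_of_hasDerivWithinAt_zero {u : ℝ → ℝ} {s : Set ℝ} (hs : Convex ℝ s)
    (hu : ∀ x ∈ s, HasDerivWithinAt u 0 s x) {x y : ℝ} (hx : x ∈ s) (hy : y ∈ s) :
    u x = u y := by
  have h := hs.norm_image_sub_le_of_norm_hasDerivWithin_le (C := 0) hu (by simp) hy hx
  rw [zero_mul, norm_le_zero_iff] at h
  exact sub_eq_zero.1 h

theorem Solves.eqOn {θ₀ c : ℝ} (hθ₀ : θ₀ ∈ Set.Ioo 0 Real.pi) {f ℓ₁ ℓ₂ : ℝ → ℝ}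
    (h₁ : Solves θ₀ c f ℓ₁) (h₂ : Solves θ₀ c f ℓ₂) : Set.EqOn ℓ₁ ℓ₂ (Set.Icc 0 θ₀) := by
  obtain ⟨hc₁, hC₁, ho₁, hz₁, hn₁⟩ := h₁
  obtain ⟨hc₂, hC₂, ho₂, hz₂, hn₂⟩ := h₂
  set s := Set.Ioc 0 θ₀ with hs
  have hU : UniqueDiffOn ℝ s := uniqueDiffOn_Ioc _ _
  have hcv : Convex ℝ s := convex_Ioc _ _
  have hmem : θ₀ ∈ s := ⟨hθ₀.1, le_rfl⟩
  have hsin : ∀ x ∈ s, Real.sin x ≠ 0 := fun x hx =>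
    (Real.sin_pos_of_pos_of_lt_pi hx.1 (hx.2.trans_lt hθ₀.2)).ne'
  have hD : ∀ {ℓ : ℝ → ℝ}, ContDiffOn ℝ 2 ℓ s → ∀ x ∈ s,
      HasDerivWithinAt ℓ (derivWithin ℓ s x) s x := fun h x hx =>
    (h.differentiableOn (by norm_num) x hx).hasDerivWithinAt
  have hDD : ∀ {ℓ : ℝ → ℝ}, ContDiffOn ℝ 2 ℓ s → ∀ x ∈ s,
      HasDerivWithinAt (derivWithin ℓ s) (derivWithin (derivWithin ℓ s) s x) s x := fun h x hx =>
    ((h.derivWithin hU (m := 1) (by norm_num)).differentiableOn (by norm_num) x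
      hx).hasDerivWithinAt
  have hw : ∀ x ∈ s, HasDerivWithinAt
      (fun y => (derivWithin ℓ₁ s y - derivWithin ℓ₂ s y) / Real.sin y) 0 s x := by
    intro x hx
    refine (((hDD hC₁ x hx).sub (hDD hC₂ x hx)).div
      (Real.hasDerivAt_sin x).hasDerivWithinAt (hsin x hx)).congr_deriv ?_
    rw [div_eq_zero_iff]
    left
    refine (mul_eq_zero.1 ?_).resolve_left (hsin x hx)
    simp only [Pi.sub_apply]
    linear_combination ho₁ x hx - ho₂ x hx
  have hv : ∀ x ∈ s, derivWithin ℓ₁ s x - derivWithin ℓ₂ s x = 0 := by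
    intro x hx
    have h := eqOn_of_hasDerivWithinAt_zero hcv hw hx hmem
    simp only [hn₁, hn₂, sub_self, zero_div] at h
    exact (div_eq_zero_iff.1 h).resolve_right (hsin x hx)
  have hu : ∀ x ∈ s, HasDerivWithinAt (ℓ₁ - ℓ₂) 0 s x := fun x hx => by
    simpa only [hv x hx] using (hD hC₁ x hx).sub (hD hC₂ x hx)
  have hEq : Set.EqOn (ℓ₁ - ℓ₂) (fun _ => (ℓ₁ - ℓ₂) θ₀) (Set.Icc 0 θ₀) :=
    Set.EqOn.of_subset_closure (s := s)
      (fun x hx => eqOn_of_hasDerivWithinAt_zero hcv hu hx hmem) (hc₁.sub hc₂)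
      continuousOn_const Set.Ioc_subset_Icc_self (closure_Ioc hθ₀.1.ne).ge
  intro x hx
  have h := (hEq hx).trans (hEq ⟨le_rfl, hθ₀.1.le⟩).symm
  simp only [Pi.sub_apply, hz₁, hz₂, sub_self] at h
  exact sub_eq_zero.1 h

/-- existence and uniqueness for the boundary value problem
`sin²θ · ℓ'' − sinθ cosθ · ℓ' = 2 f`, `ℓ(0) = c`, `ℓ'(θ₀) = 0`, given
`f = O(θ⁴)` continuous; the solution satisfies
`ℓ'(θ) = −2 sin θ ∫_θ^{θ₀} csc³(φ) f(φ) dφ`. -/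
theorem stmt_19 (n : ℕ) (hn : 2 ≤ n) (θ₀ : ℝ) (hθ₀ : θ₀ ∈ Set.Ioo 0 Real.pi)
    (c : ℝ) (f : ℝ → ℝ)
    (hfc : ContinuousOn f (Set.Ioc 0 θ₀))
    (hfO : f =O[nhdsWithin 0 (Set.Ioi 0)] fun θ => θ ^ 4) :
    (∃ ℓ : ℝ → ℝ, Solves θ₀ c f ℓ ∧
      ∀ θ ∈ Set.Ioc 0 θ₀,
        IntegrableOn (fun φ => f φ / Real.sin φ ^ 3) (Set.Ioc θ θ₀) ∧
        derivWithin ℓ (Set.Ioc 0 θ₀) θ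
          = -2 * Real.sin θ * ∫ φ in Set.Ioc θ θ₀, f φ / Real.sin φ ^ 3) ∧
    (∀ ℓ₁ ℓ₂ : ℝ → ℝ, Solves θ₀ c f ℓ₁ → Solves θ₀ c f ℓ₂ →
      ∀ θ ∈ Set.Icc 0 θ₀, ℓ₁ θ = ℓ₂ θ) := by
  have hg := continuousOn_div_sin_cube hθ₀ hfc hfO
  obtain ⟨ℓ, hℓ, hℓ'⟩ := exists_solves hθ₀ c hg
  refine ⟨⟨ℓ, hℓ, fun θ hθ => ⟨?_, hℓ' θ hθ⟩⟩, fun ℓ₁ ℓ₂ h₁ h₂ => h₁.eqOn hθ₀ h₂⟩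
  exact (hg.integrableOn_compact isCompact_Icc).mono_set
    fun x hx => ⟨(hθ.1.trans hx.1).le, hx.2⟩
end
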